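/- arXiv:2509.00162 — 2 statements merged into one kernel-verified Lean document; each statement's English description precedes it below -/
import Mathlib

section
/- Let θ be the substitution on {a,b} with θ(a) = ab and θ(b) = aa, and let X_θ be its substitution subshift. For every continuous function p : X_θ → {1,2,3,...} such that S(x) = σ^{p(x)}(x) is a homeomorphism of X_θ, every S-orbit is dense in X_θ, and every σ-orbit is the union of exactly 2 distinct S-orbits (orbit number c = 2), the system (X_θ, S) is not a Toeplitz flow: it is not topologically conjugate to (Z, σ) for any finite alphabet D and any closure Z of the σ-orbit of a Toeplitz sequence z ∈ D^ℤ. -/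
open Set Topology Classical

noncomputable section

/-- The left shift `σ` on bi-infinite sequences: `(σ x) n = x (n+1)`. -/
def shiftMap {A : Type} (x : ℤ → A) : ℤ → A := fun n => x (n + 1)

/-- The shift by an integer amount: `shiftZ n x = σ^n x`. -/
def shiftZ {A : Type} (n : ℤ) (x : ℤ → A) : ℤ → A := fun m => x (m + n)

/-- A bi-infinite sequence is Toeplitz if every coordinate is periodically repeated. -/
def IsToeplitz {A : Type} (x : ℤ → A) : Prop :=
  ∀ i : ℤ, ∃ p : ℕ, 0 < p ∧ ∀ k : ℤ, x (i + k * (p : ℤ)) = x i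

/-- The closure of the full shift orbit of `x`. -/
def orbitClosure {A : Type} [TopologicalSpace A] (x : ℤ → A) : Set (ℤ → A) :=
  closure {y | ∃ n : ℤ, shiftZ n x = y}

/-- The finite word `x_i x_{i+1} ⋯ x_{i+n-1}`. -/
def seqWord {A : Type} (x : ℤ → A) (i : ℤ) (n : ℕ) : List A :=
  List.ofFn fun m : Fin n => x (i + (m : ℕ))

/-- Iterates `θ^k` of a substitution, applied to a letter. -/
def substPow {A : Type} (θ : A → List A) : ℕ → A → List A
  | 0, a => [a]
  | k + 1, a => (θ a).flatMap (substPow θ k)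

/-- The substitution subshift of `θ`: all sequences whose finite subwords occur in
some `θ^k(a)`. -/
def substShift {A : Type} (θ : A → List A) : Set (ℤ → A) :=
  {x | ∀ i : ℤ, ∀ n : ℕ, ∃ (k : ℕ) (a : A), (seqWord x i n).IsInfix (substPow θ k a)}

/-- The full orbit of `x` under an (invertible) map `S`, within the set `X`. -/
def orbitIn {α : Type} (S : α → α) (X : Set α) (x : α) : Set α :=
  {y | y ∈ X ∧ ∃ n : ℕ, S^[n] x = y ∨ S^[n] y = x}

/-- Every `S`-orbit within `X` is dense in `X`. -/
def MinimalOn {α : Type} [TopologicalSpace α] (S : α → α) (X : Set α) : Prop :=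
  ∀ x ∈ X, X ⊆ closure (orbitIn S X x)

/-- Every `T`-orbit in `X` is the union of exactly `c` distinct `S`-orbits. -/
def OrbitNumberOn {α : Type} (T S : α → α) (X : Set α) (c : ℕ) : Prop :=
  ∀ x ∈ X, ∃ r : Fin c → α,
    (∀ i, r i ∈ orbitIn T X x) ∧
    (∀ i j, i ≠ j → r j ∉ orbitIn S X (r i)) ∧
    (∀ y ∈ orbitIn T X x, ∃ i, y ∈ orbitIn S X (r i))

/-- `S` restricts to a homeomorphism of the subset `X`. -/
def RestrictsToHomeomorph {α : Type} [TopologicalSpace α] (S : α → α) (X : Set α) : Prop :=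
  ∃ e : X ≃ₜ X, ∀ x : X, (e x : α) = S (x : α)

/-- The systems `(X, S)` and `(Y, R)` are topologically conjugate. -/
def TopConj {α β : Type} [TopologicalSpace α] [TopologicalSpace β]
    (X : Set α) (S : α → α) (Y : Set β) (R : β → β) : Prop :=
  ∃ (hS : Set.MapsTo S X X) (hR : Set.MapsTo R Y Y) (h : X ≃ₜ Y),
    ∀ x : X, h (Set.MapsTo.restrict S X X hS x) = Set.MapsTo.restrict R Y Y hR (h x)

/-- `(Y, R)` is a topological factor of `(X, S)`. -/
def IsFactorOn {α β : Type} [TopologicalSpace α] [TopologicalSpace β]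
    (X : Set α) (S : α → α) (Y : Set β) (R : β → β) : Prop :=
  ∃ F : α → β, Set.MapsTo F X Y ∧ ContinuousOn F X ∧ Set.SurjOn F X Y ∧
    ∀ x ∈ X, F (S x) = R (F x)

/-- `(X, S)` is a Toeplitz flow: it is topologically conjugate to the orbit closure of
some Toeplitz sequence over some finite alphabet, with the shift map. -/
def IsToeplitzFlow {α : Type} [TopologicalSpace α] (X : Set α) (S : α → α) : Prop :=
  ∃ (B : Type) (_ : Fintype B) (z : ℤ → B), IsToeplitz z ∧
    (letI : TopologicalSpace B := ⊥
     TopConj X S (orbitClosure z) shiftMap)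

/-- `Per_p(x)`: the set of positions where `x` is periodic with period `p`. -/
def PerSet {A : Type} (x : ℤ → A) (p : ℕ) : Set ℤ :=
  {k | ∀ n : ℤ, x (k + n * (p : ℤ)) = x k}

/-- `p` is an essential period of `x`. -/
def IsEssentialPeriod {A : Type} (x : ℤ → A) (p : ℕ) : Prop :=
  0 < p ∧ ¬ ∃ q : ℕ, 0 < q ∧ q < p ∧
    ((fun k => k + (q : ℤ)) '' PerSet x p = PerSet x p) ∧
    (∀ k ∈ PerSet x p, x (k + (q : ℤ)) = x k)

/-- A period structure for a Toeplitz sequence `x`. -/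
def IsPeriodStructure {A : Type} (x : ℤ → A) (p : ℕ → ℕ) : Prop :=
  StrictMono p ∧ (∀ k, IsEssentialPeriod x (p k)) ∧
  (∀ k, p k ∣ p (k + 1)) ∧ (⋃ k, PerSet x (p k)) = Set.univ

/-- `x` is a (σ-)periodic sequence. -/
def IsPeriodicSeq {A : Type} (x : ℤ → A) : Prop :=
  ∃ n : ℕ, 0 < n ∧ ∀ m : ℤ, x (m + (n : ℤ)) = x m

/-- `z` is the bi-infinite concatenation of the `ψ`-images of the letters of `y`,
with `ψ(y₀)` beginning at coordinate `0`. -/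
def IsConcat {B C : Type} (ψ : B → List C) (y : ℤ → B) (z : ℤ → C) : Prop :=
  ∃ s : ℤ → ℤ, s 0 = 0 ∧
    (∀ n : ℤ, s (n + 1) = s n + ((ψ (y n)).length : ℤ)) ∧
    (∀ n : ℤ, ∀ j : Fin (ψ (y n)).length, z (s n + (j : ℕ)) = (ψ (y n)).get j)

/-- `p(x,n) = Σ_{i<n} p(Sⁱ x)`. -/
def psum {X : Type} (p : X → ℕ) (S : X → X) (x : X) (n : ℕ) : ℕ :=
  ∑ i ∈ Finset.range n, p (S^[i] x)


/-- The substitution θ(a) = ab, θ(b) = aa on the alphabet {a, b} = Fin 2 (a = 0, b = 1). -/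
def theta : Fin 2 → List (Fin 2) := fun i => if i = 0 then [0, 1] else [0, 0]

/-! ### Part 1: the fibre relation of the odometer factor of a Toeplitz flow -/

lemma exists_window_period {B : Type} (z : ℤ → B) (hz : IsToeplitz z) (L : ℕ) :
    ∃ q : ℕ, 0 < q ∧ ∀ i : ℤ, -(L : ℤ) ≤ i → i ≤ L → ∀ k : ℤ, z (i + k * (q : ℤ)) = z i := by
  choose f hf0 hf using hz
  refine ⟨∏ i ∈ Finset.Icc (-(L : ℤ)) L, f i, Finset.prod_pos fun i _ => hf0 i, ?_⟩
  intro i h1 h2 k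
  obtain ⟨c, hc⟩ := Finset.dvd_prod_of_mem f (Finset.mem_Icc.2 ⟨h1, h2⟩)
  rw [hc]
  push_cast
  have := hf i (k * c)
  rw [← this]
  congr 1
  ring

/-- Residues `r` modulo `q` at which `w` sees the window pattern of `z`. -/
def resSet {B : Type} (z : ℤ → B) (L q : ℕ) [NeZero q] (w : ℤ → B) : Finset (ZMod q) :=
  Finset.univ.filter fun r => ∀ i : ℤ, -(L : ℤ) ≤ i → i ≤ L → ∀ n : ℤ,
    (n : ZMod q) + r = (i : ZMod q) → w n = z i

lemma mem_resSet {B : Type} (z : ℤ → B) (L q : ℕ) [NeZero q] (w : ℤ → B) (r : ZMod q) :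
    r ∈ resSet z L q w ↔ ∀ i : ℤ, -(L : ℤ) ≤ i → i ≤ L → ∀ n : ℤ,
    (n : ZMod q) + r = (i : ZMod q) → w n = z i := by
  simp [resSet]

lemma resSet_shift {B : Type} (z : ℤ → B) (L q : ℕ) [NeZero q] (w : ℤ → B) :
    resSet z L q (shiftMap w) = (resSet z L q w).map (Equiv.addRight (1 : ZMod q)).toEmbedding := by
  ext r
  rw [Finset.mem_map_equiv, mem_resSet, mem_resSet]
  simp only [shiftMap, Equiv.addRight_symm, Equiv.coe_addRight]
  constructor
  · intro h i h1 h2 n hn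
    have := h i h1 h2 (n - 1) (by push_cast; rw [← hn]; ring)
    simpa using this
  · intro h i h1 h2 n hn
    exact h i h1 h2 (n + 1) (by push_cast; rw [← hn]; ring)

lemma isClosed_mem_resSet {X B : Type} [TopologicalSpace X] [TopologicalSpace B]
    [DiscreteTopology B] (h : X → ℤ → B) (hc : Continuous h)
    (z : ℤ → B) (L q : ℕ) [NeZero q] (r : ZMod q) :
    IsClosed {u | r ∈ resSet z L q (h u)} := by
  simp only [mem_resSet, Set.ofPred_forall]
  refine isClosed_iInter fun i => isClosed_iInter fun _ => isClosed_iInter fun _ =>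
    isClosed_iInter fun n => isClosed_iInter fun _ => ?_
  exact isClosed_eq ((continuous_apply n).comp hc) continuous_const

lemma resSet_isClosed_fiber {X B : Type} [TopologicalSpace X] [TopologicalSpace B]
    [DiscreteTopology B] (S : X ≃ₜ X)
    (hmin : ∀ F : Set X, IsClosed F → F.Nonempty → (∀ u, u ∈ F ↔ S u ∈ F) → F = Set.univ)
    (h : X → ℤ → B) (hc : Continuous h) (hS : ∀ u, h (S u) = shiftMap (h u))
    (z : ℤ → B) (L q : ℕ) [NeZero q] (F : Set (Finset (ZMod q))) :
    IsClosed {u | resSet z L q (h u) ∈ F} := by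
  have hcard : ∀ N : ℕ, IsClosed {u | N ≤ (resSet z L q (h u)).card} := by
    intro N
    have : {u | N ≤ (resSet z L q (h u)).card} =
        ⋃ G : {G : Finset (ZMod q) // N ≤ G.card}, ⋂ r : {r // r ∈ G.1},
          {u | r.1 ∈ resSet z L q (h u)} := by
      ext u
      simp only [Set.mem_ofPred_eq, Set.mem_iUnion, Set.mem_iInter, Subtype.forall, Subtype.exists]
      constructor
      · intro hu
        exact ⟨_, hu, fun a ha => ha⟩
      · rintro ⟨G, hG, hG2⟩
        exact hG.trans (Finset.card_le_card hG2)
    rw [this]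
    exact isClosed_iUnion_of_finite fun G => isClosed_iInter fun r =>
      isClosed_mem_resSet h hc z L q r.1
  have hconst : ∀ u v, (resSet z L q (h u)).card ≤ (resSet z L q (h v)).card := by
    intro u v
    have := hmin _ (hcard (resSet z L q (h u)).card) ⟨u, by simp⟩ (by
      intro w
      simp only [Set.mem_ofPred_eq, hS, resSet_shift, Finset.card_map])
    have hv : v ∈ (Set.univ : Set X) := Set.mem_univ v
    rw [← this] at hv
    exact hv
  have hfib : ∀ G : Finset (ZMod q), IsClosed {u | resSet z L q (h u) = G} := by
    intro G
    by_cases hne : ∃ v, resSet z L q (h v) = G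
    · obtain ⟨v, hv⟩ := hne
      have : {u | resSet z L q (h u) = G} = ⋂ r : {r // r ∈ G},
          {u | r.1 ∈ resSet z L q (h u)} := by
        ext u
        simp only [Set.mem_ofPred_eq, Set.mem_iInter, Subtype.forall]
        constructor
        · intro hu a ha
          rw [hu]; exact ha
        · intro hu
          exact (Finset.eq_of_subset_of_card_le hu (by rw [← hv]; exact hconst u v)).symm
      rw [this]
      exact isClosed_iInter fun r => isClosed_mem_resSet h hc z L q r.1
    · have : {u | resSet z L q (h u) = G} = ∅ := by
        ext u
        simp only [Set.mem_ofPred_eq, Set.mem_empty_iff_false, iff_false]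
        exact fun hu => hne ⟨u, hu⟩
      rw [this]; exact isClosed_empty
  have : {u | resSet z L q (h u) ∈ F} = ⋃ G : {G // G ∈ F}, {u | resSet z L q (h u) = G.1} := by
    ext u; simp
  rw [this]
  exact isClosed_iUnion_of_finite fun G => hfib G.1

/-- The properties of the fibre relation that are used. -/
structure FibRel {X : Type} [TopologicalSpace X] (S : X ≃ₜ X) (y0 : X)
    (Rel : X → X → Prop) : Prop where
  refl : ∀ u, Rel u u
  symm : ∀ u v, Rel u v → Rel v u
  trans : ∀ u v w, Rel u v → Rel v w → Rel u w
  map : ∀ u v, Rel u v ↔ Rel (S u) (S v)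
  closed : ∀ f : X → X, Continuous f → IsClosed {u | Rel u (f u)}
  sing : ∀ v, Rel y0 v → v = y0
  back : ∀ u v, (∀ C : Set X, IsClopen C →
    ∀ᶠ n : ℕ in Filter.atTop, (S.symm^[n] u ∈ C ↔ S.symm^[n] v ∈ C)) → Rel u v
  forw : ∀ u v, (∀ C : Set X, IsClopen C →
    ∀ᶠ n : ℕ in Filter.atTop, (S^[n] u ∈ C ↔ S^[n] v ∈ C)) → Rel u v

lemma exists_fibRel {X B : Type} [TopologicalSpace X] [TopologicalSpace B]
    [DiscreteTopology B] (S : X ≃ₜ X)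
    (hmin : ∀ F : Set X, IsClosed F → F.Nonempty → (∀ u, u ∈ F ↔ S u ∈ F) → F = Set.univ)
    (h : X → ℤ → B) (hc : Continuous h) (hinj : Function.Injective h)
    (hS : ∀ u, h (S u) = shiftMap (h u))
    (z : ℤ → B) (hz : IsToeplitz z) (y0 : X) (hy : h y0 = z) :
    ∃ Rel : X → X → Prop, FibRel S y0 Rel := by
  choose q hq0 hq using exists_window_period z hz
  have hne : ∀ L, NeZero (q L) := fun L => ⟨(hq0 L).ne'⟩
  let R : ∀ L : ℕ, X → Finset (ZMod (q L)) := fun L u => resSet z L (q L) (h u)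
  have hRcl : ∀ L (F : Set (Finset (ZMod (q L)))), IsClosed {u | R L u ∈ F} := fun L F =>
    resSet_isClosed_fiber S hmin h hc hS z L (q L) F
  have hRclop : ∀ L (G : Finset (ZMod (q L))), IsClopen {u | R L u = G} := fun L G =>
    ⟨hRcl L {G}, by
      have := (hRcl L {G}ᶜ).isOpen_compl
      convert this using 1
      ext u; simp⟩
  have hmap : ∀ L u v, R L u = R L v ↔ R L (S u) = R L (S v) := by
    intro L u v
    simp only [R, hS, resSet_shift]
    exact (Finset.map_injective _).eq_iff.symm
  have hmapn : ∀ n L u v, R L u = R L v ↔ R L (S^[n] u) = R L (S^[n] v) := by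
    intro n
    induction n with
    | zero => intro L u v; rfl
    | succ n ih =>
      intro L u v
      rw [Function.iterate_succ_apply, Function.iterate_succ_apply, ← ih, hmap]
  have hmaps : ∀ n L u v, R L u = R L v ↔ R L (S.symm^[n] u) = R L (S.symm^[n] v) := by
    intro n L u v
    have hi : Function.LeftInverse S^[n] S.symm^[n] :=
      Function.LeftInverse.iterate (fun x => S.apply_symm_apply x) n
    rw [hmapn n L (S.symm^[n] u), hi u, hi v]
  refine ⟨fun u v => ∀ L, R L u = R L v, ?_, ?_, ?_, ?_, ?_, ?_, ?_, ?_⟩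
  · exact fun u L => rfl
  · exact fun u v h L => (h L).symm
  · exact fun u v w h1 h2 L => (h1 L).trans (h2 L)
  · exact fun u v => forall_congr' fun L => hmap L u v
  · intro f hf
    rw [Set.ofPred_forall]
    refine isClosed_iInter fun L => ?_
    have : {u | R L u = R L (f u)} =
        ⋃ G : Finset (ZMod (q L)), {u | R L u = G} ∩ f ⁻¹' {u | R L u = G} := by
      ext u
      simp only [Set.mem_ofPred_eq, Set.mem_iUnion, Set.mem_inter_iff, Set.mem_preimage]
      exact ⟨fun h => ⟨_, rfl, h.symm⟩, fun ⟨G, h1, h2⟩ => h1.trans h2.symm⟩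
    rw [this]
    exact isClosed_iUnion_of_finite fun G =>
      (hRclop L G).1.inter ((hRclop L G).1.preimage hf)
  · intro v hv
    apply hinj
    rw [hy]
    funext i
    have h0 : (0 : ZMod (q i.natAbs)) ∈ R i.natAbs y0 := by
      simp only [R]
      rw [mem_resSet]
      intro j h1 h2 n hn
      rw [hy]
      rw [add_zero, ZMod.intCast_eq_intCast_iff_dvd_sub] at hn
      obtain ⟨c, hcc⟩ := hn
      rw [← hq i.natAbs j h1 h2 (-c)]
      congr 1
      linear_combination -hcc
    rw [hv i.natAbs] at h0
    simp only [R] at h0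
    rw [mem_resSet] at h0
    exact h0 i (by omega) (by omega) i (by simp)
  · intro u v huv L
    have h1 : ∀ᶠ n : ℕ in Filter.atTop, ∀ G : Finset (ZMod (q L)),
        (S.symm^[n] u ∈ {u | R L u = G} ↔ S.symm^[n] v ∈ {u | R L u = G}) :=
      Filter.eventually_all.2 fun G => huv _ (hRclop L G)
    obtain ⟨n, hn⟩ := h1.exists
    exact (hmaps n L u v).2 ((hn _).1 rfl).symm
  · intro u v huv L
    have h1 : ∀ᶠ n : ℕ in Filter.atTop, ∀ G : Finset (ZMod (q L)),
        (S^[n] u ∈ {u | R L u = G} ↔ S^[n] v ∈ {u | R L u = G}) :=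
      Filter.eventually_all.2 fun G => huv _ (hRclop L G)
    obtain ⟨n, hn⟩ := h1.exists
    exact (hmapn n L u v).2 ((hn _).1 rfl).symm

/-! ### Part 2: the two threads of a speedup with orbit number two -/

/-- Abstract speedup data: a `ℤ`-action `T`, and `S u = T^{P u} u`, with two `S`-orbits in each
`T`-orbit. -/
structure Spd {X : Type} (T : ℤ → X → X) (S : Equiv.Perm X) (P : X → ℕ) : Prop where
  T0 : ∀ u, T 0 u = u
  Tadd : ∀ a b u, T (a + b) u = T a (T b u)
  Seq : ∀ u, S u = T (P u) u
  Ppos : ∀ u, 1 ≤ P u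
  two : ∀ u a b c, ¬ S.SameCycle (T a u) (T b u) → ¬ S.SameCycle (T a u) (T c u) →
    S.SameCycle (T b u) (T c u)
  ex : ∀ u a, ∃ b, ¬ S.SameCycle (T a u) (T b u)

namespace Spd

variable {X : Type} {T : ℤ → X → X} {S : Equiv.Perm X} {P : X → ℕ}

lemma S_T (H : Spd T S P) (u : X) (n : ℤ) : S (T n u) = T (n + P (T n u)) u := by
  rw [H.Seq, add_comm, H.Tadd]

lemma fwd (H : Spd T S P) (u : X) (M : ℕ) (hM : ∀ v, P v ≤ M) (k : ℕ) :
    ∀ n : ℤ, ∃ m : ℤ, n + k ≤ m ∧ m ≤ n + k * M ∧ (S ^ k) (T n u) = T m u ∧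
      (1 ≤ k → n + P (T n u) ≤ m) := by
  induction k with
  | zero => intro n; exact ⟨n, by simp, by simp, by simp, by simp⟩
  | succ k ih =>
    intro n
    obtain ⟨m, h1, h2, h3, -⟩ := ih (n + P (T n u))
    have hp := H.Ppos (T n u)
    have hq := hM (T n u)
    refine ⟨m, ?_, ?_, ?_, ?_⟩
    · push_cast; omega
    · push_cast
      have : ((P (T n u) : ℕ) : ℤ) ≤ M := by exact_mod_cast hq
      linarith
    · rw [pow_succ, Equiv.Perm.mul_apply, H.S_T, h3]
    · intro _; omega

lemma Sinv_T (H : Spd T S P) (u : X) (n : ℤ) :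
    ∃ a, S⁻¹ (T n u) = T a u ∧ a + P (T a u) = n := by
  set w := S⁻¹ (T n u) with hw
  have h1 : S w = T n u := by rw [hw]; simp
  rw [H.Seq] at h1
  have h2 : T (n - P w) u = w := by
    have : (n - (P w : ℤ)) = -(P w : ℤ) + n := by ring
    rw [this, H.Tadd, ← h1, ← H.Tadd]
    simp [H.T0]
  exact ⟨n - P w, h2.symm, by rw [h2]; ring⟩

lemma bwd (H : Spd T S P) (u : X) (M : ℕ) (hM : ∀ v, P v ≤ M) (k : ℕ) :
    ∀ n : ℤ, ∃ m : ℤ, m ≤ n - k ∧ n - k * M ≤ m ∧ (S⁻¹ ^ k) (T n u) = T m u := by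
  induction k with
  | zero => intro n; exact ⟨n, by simp, by simp, by simp⟩
  | succ k ih =>
    intro n
    obtain ⟨a, ha, ha2⟩ := H.Sinv_T u n
    obtain ⟨m, h1, h2, h3⟩ := ih a
    have hp := H.Ppos (T a u)
    have hq := hM (T a u)
    refine ⟨m, ?_, ?_, ?_⟩
    · push_cast; omega
    · push_cast
      have : ((P (T a u) : ℕ) : ℤ) ≤ M := by exact_mod_cast hq
      linarith
    · rw [pow_succ, Equiv.Perm.mul_apply, ha, h3]

lemma zpow_T (H : Spd T S P) (u : X) (M : ℕ) (hM : ∀ v, P v ≤ M) (k : ℤ) (n : ℤ) :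
    ∃ m : ℤ, |m - n| ≤ |k| * M ∧ (S ^ k) (T n u) = T m u ∧ (k ≤ 0 → m ≤ n) ∧
      (1 ≤ k → n + P (T n u) ≤ m) := by
  rcases Int.eq_nat_or_neg k with ⟨j, rfl | rfl⟩
  · obtain ⟨m, h1, h2, h3, h4⟩ := H.fwd u M hM j n
    refine ⟨m, ?_, by simpa using h3, ?_, ?_⟩
    · rw [abs_of_nonneg (by omega), abs_of_nonneg (by omega)]; linarith
    · intro h
      have : j = 0 := by omega
      subst this
      simp at h2
      exact h2
    · intro h; exact h4 (by omega)
  · obtain ⟨m, h1, h2, h3⟩ := H.bwd u M hM j n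
    refine ⟨m, ?_, ?_, ?_, ?_⟩
    · rw [abs_of_nonpos (by omega), abs_neg, abs_of_nonneg (by omega)]; linarith
    · rw [← h3]; simp
    · intro _; omega
    · intro h; omega

lemma jump (H : Spd T S P) (u : X) (M : ℕ) (hM : ∀ v, P v ≤ M)
    (hap : ∀ a b, T a u = T b u → a = b) (a b : ℤ) (hab : a < b)
    (h : S.SameCycle (T a u) (T b u)) : a + P (T a u) ≤ b := by
  obtain ⟨k, hk⟩ := h
  obtain ⟨m, -, h2, h3, h4⟩ := H.zpow_T u M hM k a
  rw [h2] at hk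
  have := hap _ _ hk
  by_cases hk0 : k ≤ 0
  · have := h3 hk0; omega
  · have := h4 (by omega); omega

/-- `b` is the position before `n` whose arrow jumps over `n`. -/
def Br (T : ℤ → X → X) (P : X → ℕ) (u : X) (n b : ℤ) : Prop :=
  b < n ∧ n < b + P (T b u)

lemma Br_not (H : Spd T S P) (u : X) (M : ℕ) (hM : ∀ v, P v ≤ M)
    (hap : ∀ a b, T a u = T b u → a = b) (n b : ℤ) (h : Br T P u n b) :
    ¬ S.SameCycle (T n u) (T b u) := by
  intro h2
  have := H.jump u M hM hap b n h.1 h2.symm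
  have := h.2
  omega

lemma exists_Br (H : Spd T S P) (u : X) (M : ℕ) (hM : ∀ v, P v ≤ M) (n : ℤ) :
    ∃ b, Br T P u n b := by
  obtain ⟨m, hm⟩ := H.ex u n
  -- move `m` to the left of `n`
  obtain ⟨m', h1, -, h3⟩ := H.bwd u M hM (m - n + 1).toNat m
  have hm' : ¬ S.SameCycle (T n u) (T m' u) := by
    intro h
    apply hm
    rw [← h3] at h
    refine h.trans ⟨((m - n + 1).toNat : ℤ), ?_⟩
    rw [zpow_natCast, inv_pow]
    exact (S ^ _).apply_symm_apply _
  have hlt : m' < n := by omega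
  clear h1 h3 hm
  obtain ⟨d, hd⟩ : ∃ d : ℕ, n - m' ≤ d := ⟨(n - m').toNat, by omega⟩
  induction d generalizing m' with
  | zero => omega
  | succ d ih =>
    by_cases hb : n < m' + P (T m' u)
    · exact ⟨m', hlt, hb⟩
    · have hp := H.Ppos (T m' u)
      have hc : ¬ S.SameCycle (T n u) (T (m' + P (T m' u)) u) := by
        intro h
        apply hm'
        refine h.trans ?_
        rw [← H.S_T]
        exact ⟨-1, by simp⟩
      have hne : m' + P (T m' u) ≠ n := by
        intro h
        rw [h] at hc
        exact hc (Equiv.Perm.SameCycle.refl _ _)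
      exact ih _ hc (by omega) (by omega)

lemma Br_unique (H : Spd T S P) (u : X) (M : ℕ) (hM : ∀ v, P v ≤ M)
    (hap : ∀ a b, T a u = T b u → a = b) (n a b : ℤ) (ha : Br T P u n a) (hb : Br T P u n b) :
    a = b := by
  have h := H.two u n a b (H.Br_not u M hM hap n a ha) (H.Br_not u M hM hap n b hb)
  obtain ⟨ha1, ha2⟩ := ha
  obtain ⟨hb1, hb2⟩ := hb
  rcases lt_trichotomy a b with h1 | h1 | h1
  · have := H.jump u M hM hap a b h1 h; omega
  · exact h1
  · have := H.jump u M hM hap b a h1 h.symm; omega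

lemma Br_step_one (H : Spd T S P) (u : X)
    (hap : ∀ a b, T a u = T b u → a = b) (n b : ℤ) (hb : Br T P u n b) (h1 : P (T n u) = 1) :
    Br T P u (n + 1) b := by
  obtain ⟨hb1, hb2⟩ := hb
  refine ⟨by omega, ?_⟩
  by_contra hc
  have he : b + P (T b u) = n + 1 := by omega
  have h2 : S (T b u) = S (T n u) := by
    rw [H.S_T, H.S_T, he, h1]; rfl
  have := hap _ _ (S.injective h2)
  omega

lemma Br_step_two (H : Spd T S P) (u : X) (M : ℕ) (hM : ∀ v, P v ≤ M)
    (hap : ∀ a b, T a u = T b u → a = b) (n b : ℤ) (hb : Br T P u n b) (h1 : P (T n u) ≠ 1) :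
    S (T b u) = T (n + 1) u ∧ Br T P u (n + 1) n := by
  have hp := H.Ppos (T n u)
  obtain ⟨a, ha1, ha2⟩ := H.Sinv_T u (n + 1)
  have hpa := H.Ppos (T a u)
  have hne : a ≠ n := by
    rintro rfl
    omega
  have hba : a = b := H.Br_unique u M hM hap n a b ⟨by omega, by omega⟩ hb
  subst hba
  refine ⟨?_, by omega, by omega⟩
  rw [← ha1]; simp

lemma same_succ (H : Spd T S P) (u : X) (M : ℕ) (hM : ∀ v, P v ≤ M)
    (hap : ∀ a b, T a u = T b u → a = b) (n : ℤ) :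
    S.SameCycle (T n u) (T (n + 1) u) ↔ P (T n u) = 1 := by
  constructor
  · intro h
    have := H.jump u M hM hap n (n + 1) (by omega) h
    have := H.Ppos (T n u)
    omega
  · intro h
    refine ⟨1, ?_⟩
    rw [zpow_one, H.S_T, h]; rfl

/-- The sign of a point. -/
def sg (P : X → ℕ) (v : X) : ℤ := if P v = 1 then 1 else -1

lemma prod_sg (P : X → ℕ) (f : ℕ → X) (l : ℕ) :
    (∏ i ∈ Finset.range l, sg P (f i)) = 1 ∨ (∏ i ∈ Finset.range l, sg P (f i)) = -1 := by
  induction l with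
  | zero => left; simp
  | succ l ih =>
    rw [Finset.prod_range_succ]
    unfold sg at *
    split_ifs <;> rcases ih with h | h <;> simp [h]

lemma same_iff (H : Spd T S P) (u : X) (M : ℕ) (hM : ∀ v, P v ≤ M)
    (hap : ∀ a b, T a u = T b u → a = b) (n : ℤ) (l : ℕ) :
    S.SameCycle (T n u) (T (n + l) u) ↔ ∏ i ∈ Finset.range l, sg P (T (n + i) u) = 1 := by
  induction l with
  | zero => simp [Equiv.Perm.SameCycle.refl]
  | succ l ih =>
    rw [Finset.prod_range_succ]
    have hs := H.same_succ u M hM hap (n + l)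
    have e : n + ((l + 1 : ℕ) : ℤ) = n + l + 1 := by push_cast; ring
    rw [e]
    by_cases hP : P (T (n + l) u) = 1
    · have h1 := hs.2 hP
      have hsg : sg P (T (n + l) u) = 1 := by simp [sg, hP]
      rw [hsg, mul_one, ← ih]
      exact ⟨fun h => h.trans h1.symm, fun h => h.trans h1⟩
    · have h1 : ¬ S.SameCycle (T (n + l) u) (T (n + l + 1) u) := fun h => hP (hs.1 h)
      have hsg : sg P (T (n + l) u) = -1 := by simp [sg, hP]
      rw [hsg]
      rcases prod_sg P (fun i : ℕ => T (n + i) u) l with hh | hh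
      · rw [hh]
        have := ih.2 hh
        constructor
        · intro h; exact absurd (this.symm.trans h) h1
        · intro h; norm_num at h
      · rw [hh]
        have h2 : ¬ S.SameCycle (T n u) (T (n + l) u) := by
          intro h
          have := ih.1 h
          rw [this] at hh
          norm_num at hh
        constructor
        · intro _; norm_num
        · intro _
          exact H.two u (n + l) n (n + l + 1) (fun h => h2 h.symm) h1

/-- The affine step for the difference of the two thread clocks. -/
def st (P : X → ℕ) (v : X) (δ : ℤ) : ℤ := 1 + sg P v * δ

/-- The composition of `l` affine steps. -/
def fold (P : X → ℕ) (f : ℕ → X) : ℕ → ℤ → ℤ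
  | 0, δ => δ
  | l + 1, δ => st P (f l) (fold P f l δ)

lemma fold_affine (P : X → ℕ) (f : ℕ → X) (l : ℕ) :
    ∃ C : ℤ, ∀ δ, fold P f l δ = (∏ i ∈ Finset.range l, sg P (f i)) * δ + C := by
  induction l with
  | zero => exact ⟨0, fun δ => by simp [fold]⟩
  | succ l ih =>
    obtain ⟨C, hC⟩ := ih
    refine ⟨1 + sg P (f l) * C, fun δ => ?_⟩
    rw [fold, st, hC, Finset.prod_range_succ]
    ring

lemma fold_congr (P : X → ℕ) (f g : ℕ → X) (l : ℕ) (h : ∀ i < l, P (f i) = P (g i)) (δ : ℤ) :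
    fold P f l δ = fold P g l δ := by
  induction l with
  | zero => rfl
  | succ l ih =>
    rw [fold, fold, ih fun i hi => h i (by omega), st, st, sg, sg, h l (by omega)]

lemma abs_fold (P : X → ℕ) (f : ℕ → X) (l : ℕ) (δ : ℤ) : |fold P f l δ| ≤ |δ| + l := by
  induction l with
  | zero => simp [fold]
  | succ l ih =>
    rw [fold, st]
    have h1 : |sg P (f l)| = 1 := by unfold sg; split_ifs <;> simp
    calc |1 + sg P (f l) * fold P f l δ| ≤ |1| + |sg P (f l) * fold P f l δ| := abs_add_le _ _
      _ = 1 + |fold P f l δ| := by rw [abs_mul, h1]; simp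
      _ ≤ _ := by push_cast; linarith

section Rel

variable {Rel : X → X → Prop}

lemma rel_zpow (hr : ∀ u v, Rel u v ↔ Rel (S u) (S v)) (k : ℤ) (u v : X) :
    Rel u v ↔ Rel ((S ^ k) u) ((S ^ k) v) := by
  induction k with
  | zero => simp
  | succ k ih => rw [ih, hr, add_comm, zpow_add]; simp
  | pred k ih =>
    rw [ih, hr ((S ^ (-(k : ℤ) - 1)) u)]
    have : ∀ w, S ((S ^ (-(k : ℤ) - 1)) w) = (S ^ (-(k : ℤ))) w := by
      intro w
      rw [← Equiv.Perm.mul_apply, ← zpow_one_add]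
      congr 2
      ring
    rw [this, this]

/-- The relation between the two threads. -/
def Qr (T : ℤ → X → X) (S : Equiv.Perm X) (P : X → ℕ) (Rel : X → X → Prop) (u : X)
    (n δ : ℤ) : Prop :=
  ∃ b, Br T P u n b ∧ Rel (T n u) ((S ^ δ) (T b u))

lemma Qr_step (H : Spd T S P) (hr : ∀ u v, Rel u v ↔ Rel (S u) (S v))
    (hsymm : ∀ u v, Rel u v → Rel v u) (u : X) (M : ℕ) (hM : ∀ v, P v ≤ M)
    (hap : ∀ a b, T a u = T b u → a = b) (n δ : ℤ) :
    Qr T S P Rel u n δ ↔ Qr T S P Rel u (n + 1) (st P (T n u) δ) := by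
  obtain ⟨b, hb⟩ := H.exists_Br u M hM n
  have e1 : ∀ n b δ, Br T P u n b → (Qr T S P Rel u n δ ↔ Rel (T n u) ((S ^ δ) (T b u))) := by
    intro n b δ hb
    constructor
    · rintro ⟨b', hb', h⟩
      rwa [H.Br_unique u M hM hap n b b' hb hb']
    · intro h; exact ⟨b, hb, h⟩
  rw [e1 n b δ hb]
  by_cases hP : P (T n u) = 1
  · rw [e1 (n + 1) b _ (H.Br_step_one u hap n b hb hP)]
    have h1 : T (n + 1) u = S (T n u) := by rw [H.S_T, hP]; rfl
    have h2 : st P (T n u) δ = 1 + δ := by simp [st, sg, hP]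
    rw [h1, h2, zpow_add, zpow_one, Equiv.Perm.mul_apply, ← hr]
  · obtain ⟨h1, h2⟩ := H.Br_step_two u M hM hap n b hb hP
    rw [e1 (n + 1) n _ h2, ← h1]
    have h3 : st P (T n u) δ = 1 + -δ := by simp [st, sg, hP]
    rw [h3, zpow_add, zpow_one, Equiv.Perm.mul_apply, ← hr, rel_zpow hr (-δ)]
    have h4 : (S ^ (-δ)) ((S ^ δ) (T b u)) = T b u := by simp
    rw [h4]
    exact ⟨hsymm _ _, hsymm _ _⟩

lemma Qr_fold (H : Spd T S P) (hr : ∀ u v, Rel u v ↔ Rel (S u) (S v))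
    (hsymm : ∀ u v, Rel u v → Rel v u) (u : X) (M : ℕ) (hM : ∀ v, P v ≤ M)
    (hap : ∀ a b, T a u = T b u → a = b) (n δ : ℤ) (l : ℕ) :
    Qr T S P Rel u n δ ↔
      Qr T S P Rel u (n + l) (fold P (fun i : ℕ => T (n + i) u) l δ) := by
  induction l with
  | zero => simp [fold]
  | succ l ih =>
    rw [ih, H.Qr_step hr hsymm u M hM hap, fold]
    push_cast
    rw [add_assoc]

lemma Qr_disp (H : Spd T S P) (u : X) (M : ℕ) (hM : ∀ v, P v ≤ M)
    (hap : ∀ a b, T a u = T b u → a = b) (n δ Δ : ℤ) (hΔ : |δ| ≤ Δ)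
    (h : Qr T S P Rel u n δ) :
    ∃ s : ℤ, s ≠ 0 ∧ |s| ≤ (Δ + 1) * M ∧ Rel (T n u) (T s (T n u)) := by
  obtain ⟨b, hb, h⟩ := h
  obtain ⟨m, h1, h2, -, -⟩ := H.zpow_T u M hM δ b
  refine ⟨m - n, ?_, ?_, ?_⟩
  · intro h0
    have : m = n := by omega
    subst this
    exact H.Br_not u M hM hap m b hb (Equiv.Perm.SameCycle.symm ⟨δ, h2⟩)
  · have h3 : |b - n| ≤ M := by
      have := hM (T b u)
      have := hb.1
      have := hb.2
      rw [abs_le]; constructor <;> omega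
    calc |m - n| = |(m - b) + (b - n)| := by congr 1; ring
      _ ≤ |m - b| + |b - n| := abs_add_le _ _
      _ ≤ |δ| * M + M := add_le_add h1 h3
      _ ≤ Δ * M + M := by gcongr
      _ = _ := by ring
  · rw [← H.Tadd, sub_add_cancel, ← h2]; exact h

end Rel

end Spd

/-! ### Part 3: the period doubling sequences -/

/-- Parity of a valuation as a letter. -/
def par (v : ℕ) : Fin 2 := if Even v then 0 else 1

/-- The two period doubling sequences which differ only at the origin. -/
def pd (e : Fin 2) : ℤ → Fin 2 := fun n => if n = 0 then e else par (padicValInt 2 n)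

lemma pd_zero (e : Fin 2) : pd e 0 = e := by simp [pd]

lemma pd_val (e : Fin 2) (v : ℕ) (t : ℤ) : pd e (2 ^ v * (2 * t + 1)) = par v := by
  have h1 : (2 * t + 1 : ℤ) ≠ 0 := by omega
  have h2 : (2 ^ v : ℤ) ≠ 0 := by positivity
  have h3 : padicValInt 2 (2 * t + 1) = 0 :=
    padicValInt.eq_zero_of_not_dvd (by push_cast; omega)
  have h4 : padicValInt 2 ((2 : ℤ) ^ v) = v := by
    have := padicValInt.of_nat (p := 2) (n := 2 ^ v)
    push_cast at this
    rw [this, padicValNat.prime_pow]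
  have : padicValInt 2 (2 ^ v * (2 * t + 1)) = v := by
    rw [padicValInt.mul h2 h1, h3, h4, add_zero]
  rw [pd, if_neg (mul_ne_zero h2 h1), this]

lemma exists_rep (n : ℤ) (hn : n ≠ 0) : ∃ (v : ℕ) (t : ℤ), n = 2 ^ v * (2 * t + 1) := by
  obtain ⟨d, hd⟩ : ∃ d : ℕ, n.natAbs ≤ d := ⟨_, le_refl _⟩
  induction d generalizing n with
  | zero => omega
  | succ d ih =>
    rcases Int.even_or_odd' n with ⟨k, hk | hk⟩
    · obtain ⟨v, t, h⟩ := ih k (by omega) (by omega)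
      exact ⟨v + 1, t, by rw [hk, h, pow_succ]; ring⟩
    · exact ⟨0, k, by rw [hk]; ring⟩

lemma exists_rep_lt (n : ℤ) (hn : n ≠ 0) (K : ℕ) (hK : |n| < 2 ^ K) :
    ∃ (v : ℕ) (t : ℤ), v < K ∧ n = 2 ^ v * (2 * t + 1) := by
  obtain ⟨v, t, h⟩ := exists_rep n hn
  refine ⟨v, t, ?_, h⟩
  by_contra hc
  push Not at hc
  have h1 : (2 : ℤ) ^ K ≤ 2 ^ v := pow_le_pow_right₀ (by norm_num) hc
  have h2 : |n| = 2 ^ v * |2 * t + 1| := by rw [h, abs_mul]; simp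
  have h3 : 1 ≤ |2 * t + 1| := Int.one_le_abs (by omega)
  have h4 : (0 : ℤ) < 2 ^ v := by positivity
  nlinarith

/-- Near a multiple of `2^K`, the sequence looks like one of the two sequences near `0`. -/
lemma pd_block (e : Fin 2) (K : ℕ) (j y : ℤ) (hy : |y| < 2 ^ K) :
    pd e (j * 2 ^ K + y) = pd (pd e (j * 2 ^ K)) y := by
  by_cases h0 : y = 0
  · subst h0; rw [pd_zero, add_zero]
  · obtain ⟨v, t, hv, h⟩ := exists_rep_lt y h0 K hy
    obtain ⟨w, rfl⟩ : ∃ w, K = v + 1 + w := ⟨K - v - 1, by omega⟩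
    have : j * 2 ^ (v + 1 + w) + y = 2 ^ v * (2 * (j * 2 ^ w + t) + 1) := by
      rw [h, pow_add, pow_add]; ring
    rw [this, pd_val, h, pd_val]

lemma pd_odd (e : Fin 2) (K : ℕ) (j : ℤ) : pd e ((2 * j + 1) * 2 ^ K) = par K := by
  rw [mul_comm, pd_val]

lemma pd_eq_of_ne (e e' : Fin 2) (n : ℤ) (hn : n ≠ 0) : pd e n = pd e' n := by
  simp [pd, hn]

lemma par_succ (K : ℕ) : par (K + 1) = par K + 1 := by
  unfold par
  by_cases h : Even K
  · simp [h, Nat.even_add_one]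
  · simp [h, Nat.even_add_one]

/-- Recognizability. -/
lemma pd_recog (e e' : Fin 2) (K : ℕ) (n n' : ℤ)
    (h : ∀ k : ℤ, 0 ≤ k → k < 2 ^ (K + 1) → pd e (n + k) = pd e' (n' + k)) :
    (2 : ℤ) ^ K ∣ n' - n := by
  by_cases h0 : n' - n = 0
  · rw [h0]; exact dvd_zero _
  obtain ⟨v, t, hv⟩ := exists_rep (n' - n) h0
  by_cases hvK : K ≤ v
  · rw [hv]; exact Dvd.dvd.mul_right (pow_dvd_pow 2 hvK) _
  exfalso
  push Not at hvK
  set k := (2 ^ (v + 1) - n) % 2 ^ (v + 2) with hk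
  have hpos : (0 : ℤ) < 2 ^ (v + 2) := by positivity
  have hk0 : 0 ≤ k := Int.emod_nonneg _ hpos.ne'
  have hk1 : k < 2 ^ (v + 2) := Int.emod_lt_of_pos _ hpos
  have hk2 : k < 2 ^ (K + 1) := lt_of_lt_of_le hk1 (pow_le_pow_right₀ (by norm_num) (by omega))
  have hdiv := Int.emod_add_mul_ediv (2 ^ (v + 1) - n) (2 ^ (v + 2))
  rw [← hk] at hdiv
  set d := (2 ^ (v + 1) - n) / 2 ^ (v + 2) with hd
  have e1 : n + k = 2 ^ (v + 1) * (2 * (-d) + 1) := by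
    have : n + k = 2 ^ (v + 1) - 2 ^ (v + 2) * d := by linear_combination hdiv
    rw [this]; ring
  have e2 : n' + k = 2 ^ v * (2 * (t - 2 * d + 1) + 1) := by
    have : n' + k = (n' - n) + (n + k) := by ring
    rw [this, e1, hv]; ring
  have := h k hk0 hk2
  rw [e1, e2, pd_val, pd_val, par_succ] at this
  revert this
  generalize par v = a
  revert a
  decide

lemma pd_aper (e : Fin 2) (a b : ℤ) (h : shiftZ a (pd e) = shiftZ b (pd e)) : a = b := by
  by_contra hne
  have h1 : b - a ≠ 0 := by omega
  obtain ⟨K, hK⟩ : ∃ K : ℕ, |b - a| < 2 ^ K := by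
    refine ⟨(b - a).natAbs, ?_⟩
    have : (b - a).natAbs < 2 ^ (b - a).natAbs := Nat.lt_two_pow_self
    rw [Int.abs_eq_natAbs]
    exact_mod_cast this
  have h2 := pd_recog e e K a b (fun k _ _ => by
    have := congrFun h k
    simp only [shiftZ] at this
    rw [add_comm a, add_comm b]; exact this)
  exact absurd (Int.eq_zero_of_abs_lt_dvd h2 hK) h1

lemma substPow_theta (k : ℕ) : ∀ c : Fin 2, (substPow theta k c).length = 2 ^ k ∧
    ∀ i : ℕ, i < 2 ^ k → (substPow theta k c)[i]? =
      some (if i + 1 = 2 ^ k then par k + c else pd 0 ((i : ℤ) + 1)) := by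
  induction k with
  | zero =>
    intro c
    refine ⟨by simp [substPow], ?_⟩
    intro i hi
    have : i = 0 := by simpa using hi
    subst this
    simp [substPow, par]
  | succ k ih =>
    intro c
    have hst : substPow theta (k + 1) c = substPow theta k 0 ++ substPow theta k (1 + c) := by
      rw [substPow]
      fin_cases c <;> simp [theta]
    obtain ⟨hl0, hg0⟩ := ih 0
    obtain ⟨hl1, hg1⟩ := ih (1 + c)
    have hpow : 2 ^ (k + 1) = 2 ^ k + 2 ^ k := by rw [pow_succ]; ring
    refine ⟨by rw [hst, List.length_append, hl0, hl1, hpow], ?_⟩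
    intro i hi
    rw [hst]
    by_cases hik : i < 2 ^ k
    · rw [List.getElem?_append_left (by omega), hg0 i hik]
      rw [if_neg (show ¬ (i + 1 = 2 ^ (k + 1)) by omega)]
      by_cases h1 : i + 1 = 2 ^ k
      · rw [if_pos h1]
        have h2 : ((i : ℤ) + 1) = 2 ^ k * (2 * 0 + 1) := by
          have : ((i + 1 : ℕ) : ℤ) = 2 ^ k := by rw [h1]; push_cast; rfl
          push_cast at this
          rw [this]; ring
        rw [h2, pd_val, add_zero]
      · rw [if_neg h1]
    · rw [List.getElem?_append_right (by omega), hl0, hg1 (i - 2 ^ k) (by omega)]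
      by_cases h1 : i + 1 = 2 ^ (k + 1)
      · rw [if_pos h1, if_pos (by omega), par_succ, add_assoc]
      · rw [if_neg h1, if_neg (by omega)]
        have h2 : ((i : ℤ) + 1) = 1 * 2 ^ k + (((i - 2 ^ k : ℕ) : ℤ) + 1) := by
          rw [Nat.cast_sub (by omega)]; push_cast; ring
        have h3 : ((i - 2 ^ k : ℕ) : ℤ) + 1 < 2 ^ k := by
          have : i - 2 ^ k + 1 < 2 ^ k := by omega
          exact_mod_cast this
        rw [h2, pd_block 0 k 1 _ (by rw [abs_of_nonneg (by positivity)]; exact h3)]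
        rw [pd_eq_of_ne 0 _ _ (by positivity)]

lemma pd_mem (e : Fin 2) : pd e ∈ substShift theta := by
  intro i n
  obtain ⟨K, hK, hKe⟩ : ∃ K : ℕ, |i| + n < 2 ^ K ∧ par K = e := by
    set N := i.natAbs + n with hN
    have hlt : ∀ m, N ≤ m → |i| + n < (2 : ℤ) ^ m := by
      intro m hm
      have h1 : m < 2 ^ m := Nat.lt_two_pow_self
      have : N < 2 ^ m := by omega
      have h2 : (N : ℤ) < 2 ^ m := by exact_mod_cast this
      rw [Int.abs_eq_natAbs]
      rw [hN] at h2
      push_cast at h2 ⊢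
      exact h2
    by_cases he : par N = e
    · exact ⟨N, hlt N le_rfl, he⟩
    · refine ⟨N + 1, hlt _ (by omega), ?_⟩
      rw [par_succ]
      revert he
      generalize par N = a
      revert a e
      decide
  refine ⟨K + 1, 0, ?_⟩
  obtain ⟨hl, hg⟩ := substPow_theta (K + 1) 0
  set l := substPow theta (K + 1) 0 with hldef
  have hi1 : -(|i|) ≤ i := neg_abs_le i
  have hi2 : i ≤ |i| := le_abs_self i
  -- offset of the word
  have hcast : ((2 ^ K : ℕ) : ℤ) = 2 ^ K := by push_cast; rfl
  have hpow : (2 ^ (K + 1) : ℕ) = 2 ^ K + 2 ^ K := by rw [pow_succ]; ring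
  set o := (2 ^ K + i - 1).toNat with ho
  have hoc : (o : ℤ) = 2 ^ K + i - 1 := by omega
  have key : seqWord (pd e) i n = (l.drop o).take n := by
    apply List.ext_getElem?
    intro m
    by_cases hm : m < n
    · rw [List.getElem?_take_of_lt hm, List.getElem?_drop, hg (o + m) (by omega),
        if_neg (by omega)]
      rw [seqWord, List.getElem?_ofFn, dif_pos hm]
      congr 1
      have h1 : ((o + m : ℕ) : ℤ) + 1 = 1 * 2 ^ K + (i + m) := by
        push_cast; rw [hoc]; ring
      rw [h1, pd_block 0 K 1 _ (by rw [abs_lt]; constructor <;> omega)]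
      have h2 : pd 0 (1 * 2 ^ K) = e := by
        have := pd_odd 0 K 0
        rw [← hKe, ← this]
        norm_num
      rw [h2]
    · rw [List.getElem?_eq_none (by simp [seqWord]; omega),
        List.getElem?_eq_none (by simp; omega)]
  rw [key]
  exact (List.take_prefix _ _).isInfix.trans (List.drop_suffix _ _).isInfix

/-! ### The subshift as a compact space with a `ℤ`-action -/

abbrev XX : Type := ↥(substShift theta)

lemma shiftZ_mem (n : ℤ) (x : ℤ → Fin 2) (hx : x ∈ substShift theta) :
    shiftZ n x ∈ substShift theta := by
  intro i k
  obtain ⟨m, a, h⟩ := hx (i + n) k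
  refine ⟨m, a, ?_⟩
  convert h using 1
  simp only [seqWord, shiftZ]
  congr 1
  funext j
  congr 1
  ring

/-- The `ℤ`-action on the subshift. -/
def TT (n : ℤ) (u : XX) : XX := ⟨shiftZ n u.1, shiftZ_mem n u.1 u.2⟩

lemma TT_apply (n : ℤ) (u : XX) (m : ℤ) : (TT n u).1 m = u.1 (m + n) := rfl

lemma continuous_TT (n : ℤ) : Continuous (TT n) := by
  refine Continuous.subtype_mk ?_ _
  exact continuous_pi fun m => (continuous_apply (m + n)).comp continuous_subtype_val

lemma TT_zero (u : XX) : TT 0 u = u := by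
  apply Subtype.ext; funext m; simp [TT_apply]

lemma TT_add (a b : ℤ) (u : XX) : TT (a + b) u = TT a (TT b u) := by
  apply Subtype.ext; funext m; simp [TT_apply, add_assoc]

lemma isClosed_XX : IsClosed (substShift theta) := by
  have : substShift theta = ⋂ (i : ℤ), ⋂ (n : ℕ),
      (fun (x : ℤ → Fin 2) => fun m : Fin n => x (i + (m : ℕ))) ⁻¹'
        {f | ∃ (k : ℕ) (a : Fin 2), (List.ofFn f).IsInfix (substPow theta k a)} := by
    ext x
    simp [substShift, seqWord]
  rw [this]
  refine isClosed_iInter fun i => isClosed_iInter fun n => ?_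
  refine IsClosed.preimage ?_ (isClosed_discrete _)
  exact continuous_pi fun m => continuous_apply _

instance : CompactSpace XX := isCompact_iff_compactSpace.1 isClosed_XX.isCompact

lemma exists_window {D : Type} [TopologicalSpace D] [DiscreteTopology D] (f : XX → D)
    (hf : Continuous f) :
    ∃ m : ℕ, ∀ u v : XX, (∀ i : ℤ, |i| ≤ m → u.1 i = v.1 i) → f u = f v := by
  by_contra hcon
  push Not at hcon
  let K : ℕ → Set (XX × XX) := fun m =>
    {w | (∀ i : ℤ, |i| ≤ m → w.1.1 i = w.2.1 i) ∧ f w.1 ≠ f w.2}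
  have hcl : ∀ m, IsClosed (K m) := by
    intro m
    have h1 : IsClosed {w : XX × XX | ∀ i : ℤ, |i| ≤ m → w.1.1 i = w.2.1 i} := by
      simp only [Set.ofPred_forall]
      refine isClosed_iInter fun i => isClosed_iInter fun _ => ?_
      refine isClosed_eq ?_ ?_
      · exact (continuous_apply i).comp (continuous_subtype_val.comp continuous_fst)
      · exact (continuous_apply i).comp (continuous_subtype_val.comp continuous_snd)
    have h2 : IsClosed {w : XX × XX | f w.1 ≠ f w.2} := by
      have h3 : Continuous fun w : XX × XX => (f w.1, f w.2) :=
        (hf.comp continuous_fst).prodMk (hf.comp continuous_snd)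
      exact (isClosed_discrete {d : D × D | d.1 ≠ d.2}).preimage h3
    exact h1.inter h2
  have hne : (⋂ m, K m).Nonempty := by
    apply IsCompact.nonempty_iInter_of_sequence_nonempty_isCompact_isClosed K
    · intro m w hw
      exact ⟨fun i hi => hw.1 i (by push_cast; omega), hw.2⟩
    · intro m
      obtain ⟨u, v, h1, h2⟩ := hcon m
      exact ⟨(u, v), h1, h2⟩
    · exact (hcl 0).isCompact
    · exact hcl
  obtain ⟨⟨u, v⟩, huv⟩ := hne
  rw [Set.mem_iInter] at huv
  refine (huv 0).2 ?_
  have : u = v := by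
    apply Subtype.ext
    funext i
    exact (huv i.natAbs).1 i (by rw [Int.abs_eq_natAbs])
  simp [this]

/-- The period doubling points of the subshift. -/
def pt (e : Fin 2) : XX := ⟨pd e, pd_mem e⟩

lemma pt_aper (e : Fin 2) (a b : ℤ) (h : TT a (pt e) = TT b (pt e)) : a = b :=
  pd_aper e a b (congrArg Subtype.val h)

/-! ### Part 4: the block structure -/

section Main

variable {S : XX ≃ₜ XX} {P : XX → ℕ} {m : ℕ}

lemma blockP (hw : ∀ u v : XX, (∀ i : ℤ, |i| ≤ m → u.1 i = v.1 i) → P u = P v)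
    (K : ℕ) (hK : 2 * m + 2 ≤ 2 ^ K) (e : Fin 2) (j : ℤ) (i : ℕ) (hi : i < 2 ^ K) :
    P (TT (j * 2 ^ K + (m + 1) + i) (pt e)) =
      P (TT (-2 ^ K + (m + 1) + i) (pt (pd e ((j + 1) * 2 ^ K)))) := by
  apply hw
  intro t ht
  rw [abs_le] at ht
  have hK' : (2 * m + 2 : ℤ) ≤ 2 ^ K := by exact_mod_cast hK
  have hi' : (i : ℤ) < 2 ^ K := by exact_mod_cast hi
  rw [TT_apply, TT_apply]
  simp only [pt]
  have : t + (j * 2 ^ K + (m + 1) + i) = (j + 1) * 2 ^ K + (t + (-2 ^ K + (m + 1) + i)) := by ring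
  rw [this, pd_block]
  rw [abs_lt]
  constructor <;> omega

lemma farP (hw : ∀ u v : XX, (∀ i : ℤ, |i| ≤ m → u.1 i = v.1 i) → P u = P v)
    (e e' : Fin 2) (a : ℤ) (ha : (m : ℤ) < |a|) : P (TT a (pt e)) = P (TT a (pt e')) := by
  apply hw
  intro t ht
  rw [TT_apply, TT_apply]
  apply pd_eq_of_ne
  intro h
  have : a = -t := by omega
  rw [this, abs_neg] at ha
  omega

/-- The sign of the level `K` block around the origin. -/
def Bl (P : XX → ℕ) (m K : ℕ) (e : Fin 2) : ℤ :=
  ∏ i ∈ Finset.range (2 ^ K), Spd.sg P (TT (-2 ^ K + (m + 1) + i) (pt e))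

lemma Bl_block (hw : ∀ u v : XX, (∀ i : ℤ, |i| ≤ m → u.1 i = v.1 i) → P u = P v)
    (K : ℕ) (hK : 2 * m + 2 ≤ 2 ^ K) (e : Fin 2) (j : ℤ) :
    ∏ i ∈ Finset.range (2 ^ K), Spd.sg P (TT (j * 2 ^ K + (m + 1) + (i : ℕ)) (pt e)) =
      Bl P m K (pd e ((j + 1) * 2 ^ K)) := by
  apply Finset.prod_congr rfl
  intro i hi
  rw [Spd.sg, Spd.sg, blockP hw K hK e j i (Finset.mem_range.1 hi)]

lemma Bl_succ (hw : ∀ u v : XX, (∀ i : ℤ, |i| ≤ m → u.1 i = v.1 i) → P u = P v)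
    (K : ℕ) (hK : 2 * m + 2 ≤ 2 ^ K) (e : Fin 2) :
    Bl P m (K + 1) e = Bl P m K (par K) * Bl P m K e := by
  have h1 := Bl_block hw K hK e (-2)
  have h2 := Bl_block hw K hK e (-1)
  have e1 : pd e ((-2 + 1) * 2 ^ K) = par K := by
    have := pd_odd e K (-1)
    rw [← this]; norm_num
  have e2 : pd e ((-1 + 1) * 2 ^ K) = e := by
    rw [neg_add_cancel, zero_mul, pd_zero]
  rw [e1] at h1
  rw [e2] at h2
  rw [← h1, ← h2, Bl]
  have hp : 2 ^ (K + 1) = 2 ^ K + 2 ^ K := by rw [pow_succ]; ring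
  rw [hp, Finset.prod_range_add]
  congr 1
  · apply Finset.prod_congr rfl
    intro i _
    congr 2
    rw [pow_succ]; ring
  · apply Finset.prod_congr rfl
    intro i _
    congr 2
    push_cast
    rw [pow_succ]; ring

lemma same_cut (H : Spd TT S.toEquiv P) (hM : ∀ v, P v ≤ m)
    (hw : ∀ u v : XX, (∀ i : ℤ, |i| ≤ m → u.1 i = v.1 i) → P u = P v)
    (K : ℕ) (hK : 2 * m + 2 ≤ 2 ^ K) (e : Fin 2) (j : ℤ) :
    Equiv.Perm.SameCycle S.toEquiv (TT (j * 2 ^ K + (m + 1)) (pt e))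
      (TT ((j + 1) * 2 ^ K + (m + 1)) (pt e)) ↔ Bl P m K (pd e ((j + 1) * 2 ^ K)) = 1 := by
  have := H.same_iff (pt e) m hM (pt_aper e) (j * 2 ^ K + (m + 1)) (2 ^ K)
  rw [Bl_block hw K hK] at this
  rw [← this]
  have h : j * 2 ^ K + ((m : ℤ) + 1) + ((2 ^ K : ℕ) : ℤ) = (j + 1) * 2 ^ K + (m + 1) := by
    push_cast; ring
  rw [h]

lemma isOpen_cyl (u : XX) (N : ℕ) : IsOpen {v : XX | ∀ i : ℤ, |i| ≤ N → v.1 i = u.1 i} := by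
  have : {v : XX | ∀ i : ℤ, |i| ≤ N → v.1 i = u.1 i} =
      ⋂ i ∈ (Finset.Icc (-(N : ℤ)) N), {v : XX | v.1 i = u.1 i} := by
    ext v
    simp [abs_le]
  rw [this]
  refine isOpen_biInter_finset fun i _ => ?_
  have hc : Continuous fun v : XX => v.1 i := (continuous_apply i).comp continuous_subtype_val
  exact (isOpen_discrete {a : Fin 2 | a = u.1 i}).preimage hc

lemma not_both (H : Spd TT S.toEquiv P) (hM : ∀ v, P v ≤ m)
    (hw : ∀ u v : XX, (∀ i : ℤ, |i| ≤ m → u.1 i = v.1 i) → P u = P v)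
    (hd : ∀ u : XX, Dense {v | Equiv.Perm.SameCycle S.toEquiv u v})
    (K : ℕ) (hK : 2 * m + 2 ≤ 2 ^ K) : ¬ ∀ e, Bl P m K e = 1 := by
  intro hB
  set u := pt 0 with hu
  have hc : ∀ j : ℤ, Equiv.Perm.SameCycle S.toEquiv (TT (0 * 2 ^ K + (m + 1)) u)
      (TT (j * 2 ^ K + (m + 1)) u) := by
    intro j
    have hs := fun j : ℤ => (same_cut H hM hw K hK 0 j).2 (hB _)
    induction j with
    | zero => exact Equiv.Perm.SameCycle.refl _ _
    | succ j ih => exact ih.trans (hs _)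
    | pred j ih =>
      have := hs (-(j : ℤ) - 1)
      rw [sub_add_cancel] at this
      exact ih.trans this.symm
  set c0 : ℤ := 0 * 2 ^ K + (m + 1) with hc0
  obtain ⟨b, hb⟩ := H.exists_Br u m hM c0
  have hnot := H.Br_not u m hM (pt_aper 0) c0 b hb
  obtain ⟨d, hdd⟩ : ∃ d : ℕ, b + d = c0 := ⟨(c0 - b).toNat, by have := hb.1; omega⟩
  set N : ℕ := 2 ^ (K + 1) + m + d with hN
  obtain ⟨v, hv1, hv2⟩ := (hd (TT c0 u)).inter_open_nonempty _ (isOpen_cyl (TT b u) N)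
    ⟨TT b u, by simp⟩
  obtain ⟨k, hk⟩ := hv2
  obtain ⟨n, -, hn, -, -⟩ := H.zpow_T u m hM k c0
  have hvn : v = TT n u := by rw [← hk, hn]
  subst hvn
  have hagree : ∀ i : ℤ, |i| ≤ N → pd 0 (i + n) = pd 0 (i + b) := fun i hi => hv1 i hi
  have hdvd := pd_recog 0 0 K b n (fun k hk0 hk1 => by
    rw [add_comm b, add_comm n]
    refine (hagree k ?_).symm
    rw [abs_of_nonneg hk0, hN]
    push_cast
    omega)
  obtain ⟨j, hj⟩ := hdvd
  have hnd : n + d = j * 2 ^ K + (m + 1) := by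
    rw [hc0] at hdd
    linear_combination hj + hdd
  have h1 := H.same_iff u m hM (pt_aper 0) b d
  have h2 := H.same_iff u m hM (pt_aper 0) n d
  have h3 : ∏ i ∈ Finset.range d, Spd.sg P (TT (n + i) u) =
      ∏ i ∈ Finset.range d, Spd.sg P (TT (b + i) u) := by
    apply Finset.prod_congr rfl
    intro i hi
    rw [Finset.mem_range] at hi
    rw [Spd.sg, Spd.sg]
    have : P (TT (n + i) u) = P (TT (b + i) u) := by
      apply hw
      intro t ht
      rw [TT_apply, TT_apply]
      have := hagree (t + i) (by
        rw [abs_le] at ht ⊢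
        rw [hN]
        push_cast
        have : (0 : ℤ) < 2 ^ (K + 1) := by positivity
        constructor <;> omega)
      have e1 : t + (n + i) = t + i + n := by ring
      have e2 : t + (b + i) = t + i + b := by ring
      rw [e1, e2]
      exact this
    rw [this]
  rw [h3, ← h1, hdd, hnd] at h2
  apply hnot
  refine (h2.1 ?_).symm
  have h4 : Equiv.Perm.SameCycle S.toEquiv (TT c0 u) (TT n u) := ⟨k, hk⟩
  exact h4.symm.trans (hc j)

lemma exists_level (H : Spd TT S.toEquiv P) (hM : ∀ v, P v ≤ m)
    (hw : ∀ u v : XX, (∀ i : ℤ, |i| ≤ m → u.1 i = v.1 i) → P u = P v)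
    (hd : ∀ u : XX, Dense {v | Equiv.Perm.SameCycle S.toEquiv u v}) :
    ∃ K : ℕ, 2 * m + 2 ≤ 2 ^ K ∧ Bl P m K (par K) = -1 ∧ Bl P m K (par K + 1) = 1 := by
  have hpm : ∀ K e, Bl P m K e = 1 ∨ Bl P m K e = -1 := fun K e => Spd.prod_sg P _ _
  have hall : ∀ (Q : Fin 2 → Prop) (a : Fin 2), Q a → Q (a + 1) → ∀ e, Q e := by
    intro Q a h1 h2 e
    have : e = a ∨ e = a + 1 := by clear h1 h2; revert a e; decide
    rcases this with h | h <;> rw [h] <;> assumption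
  set K := 2 * m + 2 with hKdef
  have hK : 2 * m + 2 ≤ 2 ^ K := by
    have : K < 2 ^ K := Nat.lt_two_pow_self
    omega
  have hK1 : 2 * m + 2 ≤ 2 ^ (K + 1) := by rw [pow_succ]; omega
  have s1 := Bl_succ hw K hK (par K)
  have s2 := Bl_succ hw K hK (par K + 1)
  have n1 := not_both H hM hw hd K hK
  have n2 := not_both H hM hw hd (K + 1) hK1
  have e2 : par K + 1 + 1 = par K := by generalize par K = a; revert a; decide
  rcases hpm K (par K) with h1 | h1 <;> rcases hpm K (par K + 1) with h2 | h2
  · exact absurd (hall _ (par K) h1 h2) n1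
  · refine ⟨K + 1, hK1, ?_, ?_⟩
    · rw [par_succ, s2, h1, h2]; norm_num
    · rw [par_succ, e2, s1, h1]; norm_num
  · exact ⟨K, hK, h1, h2⟩
  · refine absurd (hall (fun e => Bl P m (K + 1) e = 1) (par K) ?_ ?_) n2
    · rw [s1, h1]; norm_num
    · rw [s2, h1, h2]; norm_num

lemma asym_back (H : Spd TT S.toEquiv P)
    (hw : ∀ u v : XX, (∀ i : ℤ, |i| ≤ m → u.1 i = v.1 i) → P u = P v)
    (e e' : Fin 2) (k : ℕ) : ∀ n : ℤ, n ≤ -(m + 1) → ∃ a : ℤ, a ≤ n - k ∧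
      S.symm^[k] (TT n (pt e)) = TT a (pt e) ∧ S.symm^[k] (TT n (pt e')) = TT a (pt e') := by
  induction k with
  | zero => intro n _; exact ⟨n, by simp, rfl, rfl⟩
  | succ k ih =>
    intro n hn
    obtain ⟨a, ha1, ha2⟩ := H.Sinv_T (pt e) n
    have hp := H.Ppos (TT a (pt e))
    obtain ⟨c, hc1, hc2, hc3⟩ := ih a (by omega)
    refine ⟨c, by push_cast; omega, ?_, ?_⟩
    · rw [Function.iterate_succ_apply, ← hc2]
      congr 1
    · rw [Function.iterate_succ_apply, ← hc3]
      congr 1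
      rw [Homeomorph.symm_apply_eq]
      have h1 := H.S_T (pt e') a
      rw [farP hw e' e a (by rw [abs_of_neg (by omega)]; omega), ha2] at h1
      exact h1.symm

lemma asym_forw (H : Spd TT S.toEquiv P)
    (hw : ∀ u v : XX, (∀ i : ℤ, |i| ≤ m → u.1 i = v.1 i) → P u = P v)
    (e e' : Fin 2) (k : ℕ) : ∀ n : ℤ, (m + 1) ≤ n → ∃ a : ℤ, n + k ≤ a ∧
      S^[k] (TT n (pt e)) = TT a (pt e) ∧ S^[k] (TT n (pt e')) = TT a (pt e') := by
  induction k with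
  | zero => intro n _; exact ⟨n, by simp, rfl, rfl⟩
  | succ k ih =>
    intro n hn
    have hp := H.Ppos (TT n (pt e))
    obtain ⟨c, hc1, hc2, hc3⟩ := ih (n + P (TT n (pt e))) (by omega)
    refine ⟨c, by push_cast; omega, ?_, ?_⟩
    · rw [Function.iterate_succ_apply, ← hc2]
      congr 1
      exact H.S_T (pt e) n
    · rw [Function.iterate_succ_apply, ← hc3]
      congr 1
      have h1 := H.S_T (pt e') n
      rw [farP hw e' e n (by rw [abs_of_nonneg (by omega)]; omega)] at h1
      exact h1

lemma clopen_far (C : Set XX) (hC : IsClopen C) (e e' : Fin 2) :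
    ∃ N : ℕ, ∀ a : ℤ, (N : ℤ) < |a| → (TT a (pt e) ∈ C ↔ TT a (pt e') ∈ C) := by
  have hf : Continuous fun u : XX => if u ∈ C then (1 : ℕ) else 0 := by
    refine continuous_const.if ?_ continuous_const
    intro a ha
    have : frontier C = ∅ := hC.frontier_eq
    exfalso
    have ha' : a ∈ frontier C := ha
    rw [this] at ha'
    exact ha'
  obtain ⟨N, hN⟩ := exists_window _ hf
  refine ⟨N, fun a ha => ?_⟩
  have := farP hN e e' a ha
  by_cases h1 : TT a (pt e) ∈ C <;> by_cases h2 : TT a (pt e') ∈ C <;> simp [h1, h2] at this ⊢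

variable {y0 : XX} {Rel : XX → XX → Prop}

lemma rel_back (R : FibRel S y0 Rel) (H : Spd TT S.toEquiv P)
    (hw : ∀ u v : XX, (∀ i : ℤ, |i| ≤ m → u.1 i = v.1 i) → P u = P v)
    (e e' : Fin 2) (n : ℤ) (hn : n ≤ -(m + 1)) : Rel (TT n (pt e)) (TT n (pt e')) := by
  apply R.back
  intro C hC
  obtain ⟨N, hN⟩ := clopen_far C hC e e'
  filter_upwards [Filter.eventually_ge_atTop (N + 1)] with k hk
  obtain ⟨a, h1, h2, h3⟩ := asym_back H hw e e' k n hn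
  rw [h2, h3]
  apply hN
  rw [abs_of_neg (by omega)]
  omega

lemma rel_forw (R : FibRel S y0 Rel) (H : Spd TT S.toEquiv P)
    (hw : ∀ u v : XX, (∀ i : ℤ, |i| ≤ m → u.1 i = v.1 i) → P u = P v)
    (e e' : Fin 2) (n : ℤ) (hn : (m + 1) ≤ n) : Rel (TT n (pt e)) (TT n (pt e')) := by
  apply R.forw
  intro C hC
  obtain ⟨N, hN⟩ := clopen_far C hC e e'
  filter_upwards [Filter.eventually_ge_atTop (N + 1)] with k hk
  obtain ⟨a, h1, h2, h3⟩ := asym_forw H hw e e' k n hn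
  rw [h2, h3]
  apply hN
  rw [abs_of_nonneg (by omega)]
  omega

lemma exists_start (R : FibRel S y0 Rel) (H : Spd TT S.toEquiv P) (hM : ∀ v, P v ≤ m)
    (hw : ∀ u v : XX, (∀ i : ℤ, |i| ≤ m → u.1 i = v.1 i) → P u = P v)
    (K : ℕ) (hK : 2 * m + 2 ≤ 2 ^ K) (e e' : Fin 2) (he : Bl P m K e = -1)
    (he' : Bl P m K e' = 1) :
    ∃ δ, Spd.Qr TT S.toEquiv P Rel (pt e) (-1 * 2 ^ K + (m + 1)) δ := by
  have hK' : (2 * m + 2 : ℤ) ≤ 2 ^ K := by exact_mod_cast hK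
  have hr : ∀ u v, Rel u v ↔ Rel (S.toEquiv u) (S.toEquiv v) := R.map
  have s1 := same_cut H hM hw K hK e (-1)
  have s2 := same_cut H hM hw K hK e' (-1)
  rw [show ((-1 : ℤ) + 1) = 0 by norm_num, zero_mul, pd_zero, zero_add] at s1 s2
  set c : ℤ := -1 * 2 ^ K + (m + 1) with hc
  have r1 := rel_back R H hw e e' c (by omega)
  have r2 := rel_forw R H hw e e' (m + 1) le_rfl
  have h1 : ¬ Equiv.Perm.SameCycle S.toEquiv (TT c (pt e)) (TT (m + 1) (pt e)) := by
    rw [s1, he]; norm_num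
  obtain ⟨i, hi⟩ := s2.2 he'
  obtain ⟨b, hb⟩ := H.exists_Br (pt e) m hM c
  have hnb := H.Br_not (pt e) m hM (pt_aper e) c b hb
  obtain ⟨k, hk⟩ := H.two (pt e) c b (m + 1) hnb h1
  refine ⟨k - i, b, hb, ?_⟩
  rw [Spd.rel_zpow hr i] at r1
  rw [hi] at r1
  have r3 := R.trans _ _ _ r1 (R.symm _ _ r2)
  rw [← hk] at r3
  rw [Spd.rel_zpow hr i]
  convert r3 using 1
  rw [← Equiv.Perm.mul_apply, ← zpow_add]
  congr 2
  ring

lemma bounded_Qr (R : FibRel S y0 Rel) (H : Spd TT S.toEquiv P) (hM : ∀ v, P v ≤ m)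
    (hw : ∀ u v : XX, (∀ i : ℤ, |i| ≤ m → u.1 i = v.1 i) → P u = P v)
    (hd : ∀ u : XX, Dense {v | Equiv.Perm.SameCycle S.toEquiv u v}) :
    ∃ (e : Fin 2) (Δ : ℤ), ∀ n : ℤ, ∃ δ, |δ| ≤ Δ ∧ Spd.Qr TT S.toEquiv P Rel (pt e) n δ := by
  obtain ⟨K, hK, hB1, hB2⟩ := exists_level H hM hw hd
  have hr : ∀ u v, Rel u v ↔ Rel (S.toEquiv u) (S.toEquiv v) := R.map
  set e := par K with he
  obtain ⟨δs, hδs⟩ := exists_start R H hM hw K hK e (e + 1) hB1 hB2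
  have hfold := fun n δ l => H.Qr_fold hr R.symm (pt e) m hM (pt_aper e) n δ l
  set F : Fin 2 → ℤ → ℤ := fun w δ =>
    Spd.fold P (fun i : ℕ => TT (-2 ^ K + (m + 1) + i) (pt w)) (2 ^ K) δ with hF
  have hblock : ∀ j δ, Spd.Qr TT S.toEquiv P Rel (pt e) (j * 2 ^ K + (m + 1)) δ ↔
      Spd.Qr TT S.toEquiv P Rel (pt e) ((j + 1) * 2 ^ K + (m + 1))
        (F (pd e ((j + 1) * 2 ^ K)) δ) := by
    intro j δ
    rw [hfold _ δ (2 ^ K), Spd.fold_congr P _ _ (2 ^ K) (blockP hw K hK e j)]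
    have h : j * 2 ^ K + ((m : ℤ) + 1) + ((2 ^ K : ℕ) : ℤ) = (j + 1) * 2 ^ K + (m + 1) := by
      push_cast; ring
    rw [h]
  obtain ⟨C, hC⟩ : ∃ C, ∀ δ, F e δ = -δ + C := by
    obtain ⟨C, hC⟩ := Spd.fold_affine P (fun i : ℕ => TT (-2 ^ K + (m + 1) + i) (pt e)) (2 ^ K)
    refine ⟨C, fun δ => ?_⟩
    rw [hF]
    simp only
    rw [hC]
    have : ∏ i ∈ Finset.range (2 ^ K), Spd.sg P (TT (-2 ^ K + (m + 1) + (i : ℕ)) (pt e)) = -1 := hB1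
    rw [this]; ring
  obtain ⟨C', hC'⟩ : ∃ C, ∀ δ, F (e + 1) δ = δ + C := by
    obtain ⟨C, hC⟩ :=
      Spd.fold_affine P (fun i : ℕ => TT (-2 ^ K + (m + 1) + i) (pt (e + 1))) (2 ^ K)
    refine ⟨C, fun δ => ?_⟩
    rw [hF]
    simp only
    rw [hC]
    have : ∏ i ∈ Finset.range (2 ^ K),
      Spd.sg P (TT (-2 ^ K + (m + 1) + (i : ℕ)) (pt (e + 1))) = 1 := hB2
    rw [this]; ring
  have hbl2 : ∀ j : ℤ, (∀ δ, Spd.Qr TT S.toEquiv P Rel (pt e) (2 * j * 2 ^ K + (m + 1)) δ ↔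
      Spd.Qr TT S.toEquiv P Rel (pt e) (2 * (j + 1) * 2 ^ K + (m + 1)) δ) ∨
      (∀ δ, Spd.Qr TT S.toEquiv P Rel (pt e) (2 * j * 2 ^ K + (m + 1)) δ ↔
      Spd.Qr TT S.toEquiv P Rel (pt e) (2 * (j + 1) * 2 ^ K + (m + 1)) (C + C' - δ)) := by
    intro j
    have hw2 : pd e ((2 * j + 1 + 1) * 2 ^ K) = e ∨ pd e ((2 * j + 1 + 1) * 2 ^ K) = e + 1 := by
      generalize pd e ((2 * j + 1 + 1) * 2 ^ K) = a
      generalize e = b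
      revert a b
      decide
    have ee : 2 * (j + 1) = 2 * j + 1 + 1 := by ring
    rcases hw2 with h | h
    · left
      intro δ
      rw [hblock, hblock, pd_odd, h, ← he, hC, hC, ee]
      congr! 1
      ring
    · right
      intro δ
      rw [hblock, hblock, pd_odd, h, ← he, hC, hC', ee]
      congr! 1
      ring
  obtain ⟨δ0, hδ0⟩ : ∃ δ0, Spd.Qr TT S.toEquiv P Rel (pt e) (2 * 0 * 2 ^ K + (m + 1)) δ0 := by
    have := (hblock _ _).1 hδs
    rw [show ((-1 : ℤ) + 1) = 2 * 0 by norm_num] at this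
    exact ⟨_, this⟩
  have hinv : ∀ j : ℤ, Spd.Qr TT S.toEquiv P Rel (pt e) (2 * j * 2 ^ K + (m + 1)) δ0 ∨
      Spd.Qr TT S.toEquiv P Rel (pt e) (2 * j * 2 ^ K + (m + 1)) (C + C' - δ0) := by
    intro j
    induction j with
    | zero => left; exact hδ0
    | succ j ih =>
      rcases hbl2 j with h | h
      · rwa [h, h] at ih
      · rw [h, h, sub_sub_cancel] at ih
        exact ih.symm
    | pred j ih =>
      have h3 := hbl2 (-(j : ℤ) - 1)
      rw [sub_add_cancel] at h3
      rcases h3 with h | h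
      · rwa [h, h]
      · rw [h, h, sub_sub_cancel]
        exact ih.symm
  refine ⟨e, |δ0| + |C + C' - δ0| + 2 ^ (K + 1), fun n => ?_⟩
  set q := (n - (m + 1)) / 2 ^ (K + 1) with hq
  have hpos : (0 : ℤ) < 2 ^ (K + 1) := by positivity
  have hl0 := Int.emod_nonneg (n - (m + 1)) hpos.ne'
  have hl1 := Int.emod_lt_of_pos (n - (m + 1)) hpos
  have hl2 := Int.emod_add_mul_ediv (n - (m + 1)) (2 ^ (K + 1))
  rw [← hq] at hl2
  obtain ⟨l, hl⟩ := Int.eq_ofNat_of_zero_le hl0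
  rw [hl] at hl1 hl2
  have hn : 2 * q * 2 ^ K + (m + 1) + (l : ℤ) = n := by
    rw [pow_succ] at hl2
    linear_combination hl2
  have hfin : ∀ δ1, |δ1| ≤ |δ0| + |C + C' - δ0| →
      Spd.Qr TT S.toEquiv P Rel (pt e) (2 * q * 2 ^ K + (m + 1)) δ1 →
      ∃ δ, |δ| ≤ |δ0| + |C + C' - δ0| + 2 ^ (K + 1) ∧ Spd.Qr TT S.toEquiv P Rel (pt e) n δ := by
    intro δ1 h1 h2
    rw [hfold _ _ l, hn] at h2
    refine ⟨_, ?_, h2⟩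
    refine (Spd.abs_fold P _ l δ1).trans ?_
    linarith
  rcases hinv q with h | h
  · exact hfin _ (by have := abs_nonneg (C + C' - δ0); linarith) h
  · exact hfin _ (by have := abs_nonneg δ0; linarith) h

lemma final_contra (R : FibRel S y0 Rel) (H : Spd TT S.toEquiv P) (hM : ∀ v, P v ≤ m)
    (hw : ∀ u v : XX, (∀ i : ℤ, |i| ≤ m → u.1 i = v.1 i) → P u = P v)
    (hd : ∀ u : XX, Dense {v | Equiv.Perm.SameCycle S.toEquiv u v}) : False := by
  obtain ⟨e, Δ, hΔ⟩ := bounded_Qr R H hM hw hd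
  have hdisp : ∀ n : ℤ, ∃ s : ℤ, s ≠ 0 ∧ |s| ≤ (Δ + 1) * m ∧
      Rel (TT n (pt e)) (TT s (TT n (pt e))) := by
    intro n
    obtain ⟨δ, h1, h2⟩ := hΔ n
    exact H.Qr_disp (pt e) m hM (pt_aper e) n δ Δ h1 h2
  set N := (Δ + 1) * m with hN
  set V : Set XX := ⋃ s ∈ (Finset.Icc (-N) N).filter (fun s => s ≠ 0), {u | Rel u (TT s u)} with hV
  have hVc : IsClosed V := by
    refine Set.Finite.isClosed_biUnion (Finset.finite_toSet _) ?_
    intro s _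
    exact R.closed _ (continuous_TT s)
  have hsub : {v | Equiv.Perm.SameCycle S.toEquiv (pt e) v} ⊆ V := by
    rintro v ⟨k, hk⟩
    obtain ⟨n, -, hn, -, -⟩ := H.zpow_T (pt e) m hM k 0
    rw [TT_zero, hk] at hn
    subst hn
    obtain ⟨s, h1, h2, h3⟩ := hdisp n
    rw [hV]
    simp only [Set.mem_iUnion, Finset.mem_filter, Finset.mem_Icc]
    exact ⟨s, ⟨abs_le.1 h2, h1⟩, h3⟩
  have hy : y0 ∈ V := by
    have := (hd (pt e)).mono hsub
    have h2 := this.closure_eq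
    rw [hVc.closure_eq] at h2
    rw [h2]; trivial
  rw [hV] at hy
  simp only [Set.mem_iUnion, Finset.mem_filter, Finset.mem_Icc] at hy
  obtain ⟨s, ⟨-, hs0⟩, hs⟩ := hy
  have hfix := R.sing _ hs
  have hcl : IsClosed {v : XX | TT s v = v} := isClosed_eq (continuous_TT s) continuous_id
  have hsub2 : {v | Equiv.Perm.SameCycle S.toEquiv y0 v} ⊆ {v : XX | TT s v = v} := by
    rintro v ⟨k, hk⟩
    obtain ⟨n, -, hn, -, -⟩ := H.zpow_T y0 m hM k 0
    rw [TT_zero, hk] at hn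
    subst hn
    show TT s (TT n y0) = TT n y0
    rw [← TT_add, add_comm, TT_add, hfix]
  have h1 : pt 0 ∈ {v : XX | TT s v = v} := by
    have h2 := ((hd y0).mono hsub2).closure_eq
    rw [hcl.closure_eq] at h2
    rw [h2]; trivial
  have h2 : TT s (pt 0) = TT 0 (pt 0) := by rw [TT_zero]; exact h1
  exact hs0 (pt_aper 0 _ _ h2)

end Main

/-! ### Part 5: assembly -/

lemma iterate_shiftMap {A : Type} (k : ℕ) (x : ℤ → A) :
    shiftMap^[k] x = shiftZ (k : ℤ) x := by
  induction k generalizing x with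
  | zero => funext i; simp [shiftZ]
  | succ k ih =>
    rw [Function.iterate_succ_apply, ih]
    funext i
    simp only [shiftZ, shiftMap]
    congr 1
    push_cast
    ring

lemma orbitIn_shift (u v : XX) :
    v.1 ∈ orbitIn shiftMap (substShift theta) u.1 ↔ ∃ n : ℤ, v = TT n u := by
  constructor
  · rintro ⟨-, n, h | h⟩
    · refine ⟨n, Subtype.ext ?_⟩
      rw [← h, iterate_shiftMap]
      rfl
    · have h' : u = TT n v := Subtype.ext (by rw [← h, iterate_shiftMap]; rfl)
      refine ⟨-n, ?_⟩
      rw [h', ← TT_add, neg_add_cancel, TT_zero]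
  · rintro ⟨n, rfl⟩
    refine ⟨(TT n u).2, ?_⟩
    obtain ⟨k, rfl | rfl⟩ := n.eq_nat_or_neg
    · exact ⟨k, Or.inl (by rw [iterate_shiftMap]; rfl)⟩
    · refine ⟨k, Or.inr ?_⟩
      rw [iterate_shiftMap]
      change (TT k (TT (-k) u)).1 = u.1
      rw [← TT_add, add_neg_cancel, TT_zero]

lemma orbitIn_perm (f : (ℤ → Fin 2) → (ℤ → Fin 2)) (e : XX ≃ₜ XX)
    (he : ∀ x : XX, (e x : ℤ → Fin 2) = f x) (u v : XX) :
    v.1 ∈ orbitIn f (substShift theta) u.1 ↔ Equiv.Perm.SameCycle e.toEquiv u v := by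
  have hit : ∀ (n : ℕ) (w : XX), f^[n] w.1 = ((e.toEquiv ^ n : Equiv.Perm XX) w).1 := by
    intro n
    induction n with
    | zero => intro w; rfl
    | succ n ih =>
      intro w
      rw [Function.iterate_succ_apply, ← he, ih, pow_succ]
      rfl
  constructor
  · rintro ⟨-, n, h | h⟩
    · rw [hit] at h
      exact ⟨n, by rw [zpow_natCast]; exact Subtype.ext h⟩
    · rw [hit] at h
      have hvu : Equiv.Perm.SameCycle e.toEquiv v u :=
        ⟨n, by rw [zpow_natCast]; exact Subtype.ext h⟩
      exact hvu.symm
  · rintro ⟨n, hn⟩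
    refine ⟨v.2, ?_⟩
    obtain ⟨k, rfl | rfl⟩ := n.eq_nat_or_neg
    · rw [zpow_natCast] at hn
      exact ⟨k, Or.inl (by rw [hit, hn])⟩
    · refine ⟨k, Or.inr ?_⟩
      rw [hit, ← hn, zpow_neg, zpow_natCast, ← Equiv.Perm.mul_apply, mul_inv_cancel, Equiv.Perm.one_apply]

/-- no minimal bounded speedup of (X_θ, σ) with orbit number 2 is a
Toeplitz flow. -/
theorem statement5 (p : (ℤ → Fin 2) → ℕ)
    (hpos : ∀ x ∈ substShift theta, 1 ≤ p x)
    (hcont : ContinuousOn p (substShift theta))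
    (hhomeo : RestrictsToHomeomorph (fun x => shiftMap^[p x] x) (substShift theta))
    (hmin : MinimalOn (fun x => shiftMap^[p x] x) (substShift theta))
    (horb : OrbitNumberOn shiftMap (fun x => shiftMap^[p x] x) (substShift theta) 2) :
    ¬ IsToeplitzFlow (substShift theta) (fun x => shiftMap^[p x] x) := by
  rintro ⟨B, _, z, hz, hconj⟩
  letI : TopologicalSpace B := ⊥
  haveI : DiscreteTopology B := ⟨rfl⟩
  obtain ⟨hS, hR, h, hcomm⟩ := hconj
  obtain ⟨e, he⟩ := hhomeo
  have hsc := orbitIn_perm (fun x => shiftMap^[p x] x) e he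
  set P : XX → ℕ := fun u => p u.1 with hP
  have hPc : Continuous P := continuousOn_iff_continuous_restrict.1 hcont
  have heT : ∀ u, e u = TT (P u) u := by
    intro u
    apply Subtype.ext
    rw [he]
    change shiftMap^[p u.1] u.1 = _
    rw [iterate_shiftMap]
    rfl
  have hd : ∀ u : XX, Dense {v | Equiv.Perm.SameCycle e.toEquiv u v} := by
    intro u v
    rw [closure_subtype]
    have h1 := hmin u.1 u.2 v.2
    refine closure_mono ?_ h1
    intro y hy
    exact ⟨⟨y, hy.1⟩, (hsc u ⟨y, hy.1⟩).1 hy, rfl⟩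
  have hmin' : ∀ F : Set XX, IsClosed F → F.Nonempty → (∀ u, u ∈ F ↔ e u ∈ F) →
      F = Set.univ := by
    intro F hF ⟨u, hu⟩ hinv
    have hn : ∀ (n : ℕ) (w : XX), w ∈ F ↔ (e.toEquiv ^ n : Equiv.Perm XX) w ∈ F := by
      intro n
      induction n with
      | zero => intro w; exact Iff.rfl
      | succ n ih =>
        intro w
        rw [hinv w, ih, pow_succ]
        exact Iff.rfl
    apply Set.eq_univ_of_univ_subset
    rw [← (hd u).closure_eq]
    refine closure_minimal ?_ hF
    rintro v ⟨n, rfl⟩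
    obtain ⟨k, rfl | rfl⟩ := n.eq_nat_or_neg
    · rw [zpow_natCast]
      exact (hn k u).1 hu
    · rw [hn k, zpow_neg, zpow_natCast, ← Equiv.Perm.mul_apply, mul_inv_cancel, Equiv.Perm.one_apply]
      exact hu
  have key : ∀ u : XX, ∃ r0 r1 : ℤ, ¬ Equiv.Perm.SameCycle e.toEquiv (TT r0 u) (TT r1 u) ∧
      ∀ a, Equiv.Perm.SameCycle e.toEquiv (TT r0 u) (TT a u) ∨ Equiv.Perm.SameCycle e.toEquiv (TT r1 u) (TT a u) := by
    intro u
    obtain ⟨r, h1, h2, h3⟩ := horb u.1 u.2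
    obtain ⟨r0, e0⟩ := (orbitIn_shift u ⟨r 0, (h1 0).1⟩).1 (h1 0)
    obtain ⟨r1, e1⟩ := (orbitIn_shift u ⟨r 1, (h1 1).1⟩).1 (h1 1)
    refine ⟨r0, r1, ?_, ?_⟩
    · rw [← e0, ← e1, ← hsc]
      exact h2 0 1 (by decide)
    · intro a
      obtain ⟨i, hi⟩ := h3 (TT a u).1 ((orbitIn_shift u _).2 ⟨a, rfl⟩)
      rw [← e0, ← e1, ← hsc, ← hsc]
      revert hi
      revert i
      rw [Fin.forall_fin_two]
      exact ⟨Or.inl, Or.inr⟩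
  have H : Spd TT e.toEquiv P := by
    refine ⟨TT_zero, TT_add, heT, fun u => hpos u.1 u.2, ?_, ?_⟩
    · intro u a b c hab hac
      obtain ⟨r0, r1, -, hr⟩ := key u
      rcases hr a with ha | ha <;> rcases hr b with hb | hb <;> rcases hr c with hc | hc
      all_goals first
        | exact hb.symm.trans hc
        | exact absurd (ha.symm.trans hb) hab
        | exact absurd (ha.symm.trans hc) hac
    · intro u a
      obtain ⟨r0, r1, hn, hr⟩ := key u
      by_contra hcon
      push Not at hcon
      exact hn ((hcon r0).symm.trans (hcon r1))
  have hcomm' : ∀ u, (h (e u)).1 = shiftMap (h u).1 := by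
    intro u
    have h1 := congrArg Subtype.val (hcomm u)
    have h2 : e u = Set.MapsTo.restrict _ _ _ hS u := Subtype.ext (he u)
    rw [h2]
    exact h1
  have hzm : z ∈ orbitClosure z :=
    subset_closure ⟨0, by funext i; simp [shiftZ]⟩
  obtain ⟨Rel, R⟩ := exists_fibRel e hmin' (fun u => (h u).1)
    (continuous_subtype_val.comp h.continuous)
    (fun u v huv => h.injective (Subtype.ext huv)) hcomm' z hz (h.symm ⟨z, hzm⟩) (by simp)
  obtain ⟨m1, hm1⟩ := exists_window P hPc
  obtain ⟨m2, hm2⟩ := (isCompact_range hPc).bddAbove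
  refine final_contra (m := max m1 m2) R H (fun v => le_max_of_le_right (hm2 ⟨v, rfl⟩)) ?_ hd
  intro u v huv
  refine hm1 u v fun i hi => huv i (hi.trans ?_)
  exact_mod_cast le_max_left m1 m2

end
end

section
/- Let x ∈ A^ℤ be a non-periodic Toeplitz sequence over a finite alphabet A with period structure (p_k)_{k≥1}, let X be the closure of the σ-orbit of x, and let c ≥ 1 be an integer with gcd(c, p_k) = 1 for all k. Then there exists N ∈ ℕ such that (p_{N+k})_{k≥1} is a period structure for x, and there exist a finite alphabet B and a non-periodic Toeplitz sequence z ∈ B^ℤ admitting (p_{N+k})_{k≥1} as a period structure such that (X, σ^c) is topologically conjugate to the closure of the σ-orbit of z with the shift map. (In particular, (X, σ^c) and (X, σ) have the same underlying odometer.) -/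
open Set Topology Classical

noncomputable section

theorem per_add {A : Type} {x : ℤ → A} {p : ℕ} {k k' : ℤ} (hk : k ∈ PerSet x p)
    (h : (p : ℤ) ∣ k' - k) : k' ∈ PerSet x p ∧ x k' = x k := by
  obtain ⟨m, hm⟩ := h
  have e : k' = k + m * p := by linarith
  subst e
  refine ⟨fun n => ?_, hk m⟩
  rw [hk m, ← hk (m + n)]
  congr 1; ring

theorem per_mono {A : Type} {x : ℤ → A} {p q : ℕ} (h : p ∣ q) : PerSet x p ⊆ PerSet x q := by
  intro k hk n
  obtain ⟨m, rfl⟩ := h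
  have := hk (n * m)
  rw [← this]; congr 1; push_cast; ring

theorem dvd_cast {a b d : ℤ} (h : a ∣ b) (e : b = d) : a ∣ d := e ▸ h

theorem bezout_sol {c p : ℕ} (h : Nat.gcd c p = 1) (k : ℤ) : ∃ n : ℤ, (p : ℤ) ∣ c * n - k := by
  have h1 : IsCoprime (c : ℤ) (p : ℤ) := Nat.isCoprime_iff_coprime.mpr h
  obtain ⟨a, b, hab⟩ := h1
  refine ⟨a * k, -b * k, ?_⟩
  linear_combination k * hab

theorem not_ess {A : Type} {x : ℤ → A} {p : ℕ} (hp : IsEssentialPeriod x p) (d : ℤ)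
    (h : ∀ k ∈ PerSet x p, k + d ∈ PerSet x p ∧ x (k + d) = x k) : (p : ℤ) ∣ d := by
  by_contra hd
  obtain ⟨h0, hne⟩ := hp
  apply hne
  have hp0 : (0 : ℤ) < p := by exact_mod_cast h0
  have hq0 : 0 ≤ d % p := Int.emod_nonneg _ hp0.ne'
  have hq1 : d % p < p := Int.emod_lt_of_pos _ hp0
  have hq2 : d % p ≠ 0 := fun h => hd (Int.dvd_of_emod_eq_zero h)
  obtain ⟨q, hq⟩ := Int.eq_ofNat_of_zero_le hq0
  have hdq : (p : ℤ) ∣ d - q := by rw [← hq]; exact Int.dvd_self_sub_emod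
  have key : ∀ k ∈ PerSet x p, k + q ∈ PerSet x p ∧ x (k + q) = x k := by
    intro k hk
    obtain ⟨h1, h2⟩ := h k hk
    have := per_add (k' := k + q) h1 (by
      have : k + (q : ℤ) - (k + d) = -(d - q) := by ring
      rw [this]; exact hdq.neg_right)
    exact ⟨this.1, this.2.trans h2⟩
  have keyn : ∀ n : ℕ, ∀ k ∈ PerSet x p, k + n * q ∈ PerSet x p := by
    intro n
    induction n with
    | zero => intro k hk; simpa using hk
    | succ n ih =>
      intro k hk
      have := (key _ (ih k hk)).1
      convert this using 1; push_cast; ring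
  refine ⟨q, by omega, by omega, ?_, fun k hk => (key k hk).2⟩
  apply Set.Subset.antisymm
  · rintro _ ⟨k, hk, rfl⟩
    exact (key k hk).1
  · intro k hk
    refine ⟨k - q, ?_, by simp⟩
    have h1 := keyn (p - 1) k hk
    refine (per_add h1 ⟨-q, ?_⟩).1
    rw [Nat.cast_sub h0]; push_cast; ring

theorem ps_dvd {p : ℕ → ℕ} (h : ∀ k, p k ∣ p (k + 1)) {i j : ℕ} (hij : i ≤ j) : p i ∣ p j := by
  induction j, hij using Nat.le_induction with
  | base => exact dvd_rfl
  | succ n _ ih => exact ih.trans (h n)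

theorem ps_cover {A : Type} {x : ℤ → A} {p : ℕ → ℕ} (hps : IsPeriodStructure x p) (N : ℕ) (M : ℤ)
    (n : ℕ) : ∃ l, N ≤ l ∧ ∀ i : ℕ, i < n → M + i ∈ PerSet x (p l) := by
  induction n with
  | zero => exact ⟨N, le_rfl, by simp⟩
  | succ n ih =>
    obtain ⟨l, hl, h⟩ := ih
    have : M + n ∈ ⋃ k, PerSet x (p k) := by rw [hps.2.2.2]; trivial
    obtain ⟨k, hk⟩ := Set.mem_iUnion.1 this
    refine ⟨max l k, hl.trans (le_max_left _ _), fun i hi => ?_⟩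
    rcases Nat.lt_succ_iff_lt_or_eq.1 hi with hi | rfl
    · exact per_mono (ps_dvd hps.2.2.1 (le_max_left _ _)) (h i hi)
    · exact per_mono (ps_dvd hps.2.2.1 (le_max_right _ _)) hk

theorem ps_tail {A : Type} {x : ℤ → A} {p : ℕ → ℕ} (hps : IsPeriodStructure x p) (N : ℕ) :
    IsPeriodStructure x (fun k => p (N + k)) := by
  refine ⟨fun i j hij => hps.1 (by omega), fun k => hps.2.1 _, fun k => hps.2.2.1 _, ?_⟩
  rw [Set.eq_univ_iff_forall]
  intro k
  obtain ⟨l, hl, h⟩ := ps_cover hps N k 1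
  refine Set.mem_iUnion.2 ⟨l - N, ?_⟩
  have := h 0 (by omega)
  show k ∈ PerSet x (p (N + (l - N)))
  rw [show N + (l - N) = l by omega]
  simpa using this

theorem per_mul {A : Type} {x : ℤ → A} {p : ℕ → ℕ} (hps : IsPeriodStructure x p)
    {c : ℕ} (hgcd : ∀ k, Nat.gcd c (p k) = 1) (i : ℕ) {k : ℤ}
    (hk : ∀ n : ℤ, x (k + n * (c * p i)) = x k) : k ∈ PerSet x (p i) := by
  intro n
  obtain ⟨l, hl, h⟩ := ps_cover hps i (k + n * p i) 1
  have h := h 0 (by omega)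
  simp only [Nat.cast_zero, add_zero] at h
  obtain ⟨r, hr⟩ := ps_dvd hps.2.2.1 hl
  have hcr : Nat.gcd r c = 1 := by
    have := hgcd l
    rw [hr] at this
    exact (Nat.Coprime.coprime_mul_left_right this).symm
  obtain ⟨m, s, hm⟩ := bezout_sol hcr (-n)
  rw [← h m, ← hk s]
  congr 1
  rw [hr]; push_cast
  linear_combination (p i : ℤ) * hm

theorem recog {A : Type} {x : ℤ → A} {p : ℕ → ℕ} (hps : IsPeriodStructure x p) (N : ℕ) :
    ∃ L : ℕ, ∀ m m' : ℤ, (∀ t : Fin L, x (m + (t : ℕ)) = x (m' + (t : ℕ))) →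
      (p N : ℤ) ∣ m' - m := by
  have h0 : (0 : ℤ) < p N := by exact_mod_cast (hps.2.1 N).1
  have step : ∀ d : ℕ, ∃ L : ℕ, ¬ (p N : ℤ) ∣ d → ∀ m m' : ℤ, (p N : ℤ) ∣ m' - m - d →
      ∃ t : ℕ, t < L ∧ x (m + t) ≠ x (m' + t) := by
    intro d
    by_cases hd : (p N : ℤ) ∣ d
    · exact ⟨0, fun h => absurd hd h⟩
    have : ∃ k ∈ PerSet x (p N), ∃ n : ℤ, x (k + d + n * p N) ≠ x k := by
      by_contra hcon
      push Not at hcon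
      apply hd
      apply not_ess (hps.2.1 N)
      intro k hk
      have hz : x (k + d) = x k := by simpa using hcon k hk 0
      exact ⟨fun n => (hcon k hk n).trans hz.symm, hz⟩
    obtain ⟨k, hk, n, hne⟩ := this
    obtain ⟨l, hl, h⟩ := ps_cover hps N (k + d + n * p N) 1
    have h := h 0 (by omega)
    simp only [Nat.cast_zero, add_zero] at h
    have hl0 : (0 : ℤ) < p l := by exact_mod_cast (hps.2.1 l).1
    refine ⟨p l, fun _ m m' hmm => ?_⟩
    have hq0 : 0 ≤ (k + d + n * p N - m') % p l := Int.emod_nonneg _ hl0.ne'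
    have hq1 : (k + d + n * p N - m') % p l < p l := Int.emod_lt_of_pos _ hl0
    have hq2 : (p l : ℤ) ∣ (k + d + n * p N - m') - (k + d + n * p N - m') % p l :=
      Int.dvd_self_sub_emod
    obtain ⟨t, ht⟩ := Int.eq_ofNat_of_zero_le hq0
    rw [ht] at hq1 hq2
    refine ⟨t, by exact_mod_cast hq1, ?_⟩
    have e1 := (per_add (k' := m' + t) h (by
      refine dvd_cast hq2.neg_right ?_; ring)).2
    have hq3 : (p N : ℤ) ∣ (k + d + n * p N - m') - t :=
      (Int.natCast_dvd_natCast.2 (ps_dvd hps.2.2.1 hl)).trans hq2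
    have e2 := (per_add (k' := m + t) hk (by
      have := ((dvd_add hq3 hmm).neg_right).add (Dvd.intro_left n rfl : (p N : ℤ) ∣ n * p N)
      refine dvd_cast this ?_; ring)).2
    rw [e1, e2]; exact hne.symm
  choose L hL using step
  refine ⟨(Finset.range (p N)).sup L, fun m m' hag => ?_⟩
  by_contra hnd
  have hq0 : 0 ≤ (m' - m) % p N := Int.emod_nonneg _ h0.ne'
  have hq1 : (m' - m) % p N < p N := Int.emod_lt_of_pos _ h0
  have hq2 : (p N : ℤ) ∣ (m' - m) - (m' - m) % p N := Int.dvd_self_sub_emod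
  obtain ⟨d, hd⟩ := Int.eq_ofNat_of_zero_le hq0
  rw [hd] at hq1 hq2
  obtain ⟨t, ht, hne⟩ := hL d (fun h => hnd (by simpa using dvd_add hq2 h)) m m' hq2
  have hle : L d ≤ (Finset.range (p N)).sup L :=
    Finset.le_sup (Finset.mem_range.2 (by exact_mod_cast hq1))
  exact hne (hag ⟨t, ht.trans_le hle⟩)

theorem shiftZ_shiftZ {A : Type} (m n : ℤ) (x : ℤ → A) :
    shiftZ m (shiftZ n x) = shiftZ (m + n) x := by
  funext t; simp [shiftZ, add_assoc]

theorem shiftMap_iter {A : Type} (c : ℕ) : (shiftMap^[c] : (ℤ → A) → ℤ → A) = shiftZ (c : ℤ) := by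
  induction c with
  | zero => funext x t; simp [shiftZ]
  | succ n ih =>
    rw [Function.iterate_succ', ih]
    funext x t
    simp only [shiftMap, shiftZ, Function.comp]
    congr 1; push_cast; ring

theorem continuous_shiftZ {A : Type} [TopologicalSpace A] (n : ℤ) :
    Continuous (shiftZ n : (ℤ → A) → ℤ → A) :=
  continuous_pi fun m => continuous_apply (m + n)

theorem shiftZ_mem_s8 {A : Type} [TopologicalSpace A] {x y : ℤ → A} (n : ℤ)
    (hy : y ∈ orbitClosure x) : shiftZ n y ∈ orbitClosure x := by
  refine map_mem_closure (continuous_shiftZ n) hy ?_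
  rintro _ ⟨m, rfl⟩
  exact ⟨n + m, (shiftZ_shiftZ _ _ _).symm⟩

theorem self_mem {A : Type} [TopologicalSpace A] (x : ℤ → A) (n : ℤ) :
    shiftZ n x ∈ orbitClosure x := subset_closure ⟨n, rfl⟩

theorem dense_pow {A : Type} [TopologicalSpace A] [DiscreteTopology A]
    {x : ℤ → A} {p : ℕ → ℕ} (hps : IsPeriodStructure x p)
    {c : ℕ} (hgcd : ∀ k, Nat.gcd c (p k) = 1) :
    orbitClosure x = closure {y | ∃ n : ℤ, shiftZ (c * n) x = y} := by
  apply Set.Subset.antisymm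
  · refine closure_minimal ?_ isClosed_closure
    rintro _ ⟨n, rfl⟩
    rw [mem_closure_iff]
    intro U hU hmem
    obtain ⟨I, u, hI, hsub⟩ := isOpen_pi_iff.1 hU _ hmem
    have : ∃ M : ℕ, ∀ i ∈ I, i.natAbs ≤ M := ⟨I.sup Int.natAbs, fun i hi => Finset.le_sup hi⟩
    obtain ⟨M, hM⟩ := this
    obtain ⟨l, -, hl⟩ := ps_cover hps 0 (n - M) (2 * M + 1)
    obtain ⟨m, hm⟩ := bezout_sol (hgcd l) n
    refine ⟨shiftZ (c * m) x, hsub ?_, m, rfl⟩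
    intro i hi
    have hiM := hM i hi
    have h1 := hl (i + M).toNat (by omega)
    have e : n - M + ((i + M).toNat : ℤ) = i + n := by omega
    rw [e] at h1
    have h2 := (per_add (k' := i + c * m) h1 (by refine dvd_cast hm ?_; ring)).2
    have h3 := (hI i hi).2
    simp only [shiftZ] at h3 ⊢
    rw [h2]; exact h3
  · refine closure_mono ?_
    rintro _ ⟨n, rfl⟩
    exact ⟨_, rfl⟩

theorem conj_of_code {A : Type} [Fintype A] [TopologicalSpace A] [DiscreteTopology A]
    {x : ℤ → A} {p : ℕ → ℕ} (hps : IsPeriodStructure x p)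
    {c : ℕ} (hgcd : ∀ k, Nat.gcd c (p k) = 1)
    {B : Type} [TopologicalSpace B] [DiscreteTopology B] (f : (ℤ → A) → B) (hf : Continuous f)
    (hinj : ∀ y ∈ orbitClosure x, ∀ y' ∈ orbitClosure x,
      (∀ n : ℤ, f (shiftZ (c * n) y) = f (shiftZ (c * n) y')) → y = y') :
    TopConj (orbitClosure x) (shiftMap^[c]) (orbitClosure fun n : ℤ => f (shiftZ (c * n) x))
      shiftMap := by
  set F : (ℤ → A) → ℤ → B := fun y n => f (shiftZ (c * n) y) with hF
  have hFc : Continuous F := continuous_pi fun n => hf.comp (continuous_shiftZ _)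
  have hX : IsCompact (orbitClosure x) := isClosed_closure.isCompact
  have himg : F '' orbitClosure x = orbitClosure (F x) := by
    rw [dense_pow hps hgcd, image_closure_of_isCompact isClosed_closure.isCompact hFc.continuousOn]
    unfold orbitClosure
    congr 1
    have key : ∀ n : ℤ, F (shiftZ (c * n) x) = shiftZ n (F x) := by
      intro n; funext m
      simp only [hF, shiftZ_shiftZ]
      simp only [shiftZ]
      congr 2; ring
    ext w; constructor
    · rintro ⟨_, ⟨n, rfl⟩, rfl⟩; exact ⟨n, (key n).symm⟩
    · rintro ⟨n, rfl⟩; exact ⟨_, ⟨n, rfl⟩, key n⟩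
  have hmaps : Set.MapsTo F (orbitClosure x) (orbitClosure (F x)) := by
    intro y hy; rw [← himg]; exact ⟨y, hy, rfl⟩
  have hbij : Function.Bijective (hmaps.restrict F _ _) := by
    constructor
    · rintro ⟨y, hy⟩ ⟨y', hy'⟩ h
      apply Subtype.ext
      exact hinj y hy y' hy' fun n => congrFun (congrArg Subtype.val h) n
    · rintro ⟨w, hw⟩
      rw [← himg] at hw
      obtain ⟨y, hy, rfl⟩ := hw
      exact ⟨⟨y, hy⟩, rfl⟩
  haveI : CompactSpace (orbitClosure x) := isCompact_iff_compactSpace.1 hX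
  have hcont : Continuous (Equiv.ofBijective _ hbij) := hFc.restrict hmaps
  refine ⟨?_, ?_, hcont.homeoOfEquivCompactToT2, ?_⟩
  · intro y hy; rw [shiftMap_iter]; exact shiftZ_mem_s8 _ hy
  · intro y hy; exact shiftZ_mem_s8 1 hy
  · rintro ⟨y, hy⟩
    apply Subtype.ext
    show F (shiftMap^[c] y) = shiftMap (F y)
    rw [shiftMap_iter]
    funext m
    simp only [hF, shiftZ_shiftZ, shiftMap]
    congr 2; ring

theorem exists_residue {A : Type} [Fintype A] [TopologicalSpace A] [DiscreteTopology A]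
    {x : ℤ → A} {p : ℕ → ℕ} (hps : IsPeriodStructure x p) (N : ℕ) :
    ∃ ρ : (ℤ → A) → ZMod (p N), (∀ a, IsOpen (ρ ⁻¹' {a})) ∧
      ∀ m : ℤ, ρ (shiftZ m x) = (m : ZMod (p N)) := by
  obtain ⟨L, hL⟩ := recog hps N
  let g : (Fin L → A) → ZMod (p N) := fun u =>
    if h : ∃ m : ℤ, ∀ t : Fin L, x (m + (t : ℕ)) = u t then ((h.choose : ℤ) : ZMod (p N)) else 0
  refine ⟨fun y => g fun t => y (t : ℕ), fun a => ?_, fun m => ?_⟩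
  · have hc : Continuous (fun (y : ℤ → A) (t : Fin L) => y (t : ℕ)) :=
      continuous_pi fun t => continuous_apply _
    exact (isOpen_discrete (g ⁻¹' {a})).preimage hc
  · have h : ∃ m' : ℤ, ∀ t : Fin L, x (m' + (t : ℕ)) = shiftZ m x (t : ℕ) :=
      ⟨m, fun t => by simp [shiftZ, add_comm]⟩
    have e : g (fun t => shiftZ m x (t : ℕ)) = ((h.choose : ℤ) : ZMod (p N)) := dif_pos h
    show g (fun t => shiftZ m x (t : ℕ)) = _
    rw [e, ZMod.intCast_eq_intCast_iff_dvd_sub]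
    apply hL
    intro t
    rw [h.choose_spec t]; simp [shiftZ, add_comm]

/-- if gcd(c, p_k) = 1 for all k, then some tail (p_{N+k}) of the period
structure is a period structure for x, and (X, σᶜ) is conjugate to the orbit closure
of a Toeplitz sequence z admitting (p_{N+k}) as a period structure. -/
theorem statement8 {A : Type} [Fintype A] [TopologicalSpace A] [DiscreteTopology A]
    (x : ℤ → A) (hx : IsToeplitz x) (hnp : ¬ IsPeriodicSeq x)
    (p : ℕ → ℕ) (hps : IsPeriodStructure x p)
    (c : ℕ) (hc : 1 ≤ c) (hgcd : ∀ k, Nat.gcd c (p k) = 1) :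
    ∃ N : ℕ, IsPeriodStructure x (fun k => p (N + k)) ∧
      ∃ (B : Type) (_ : Fintype B) (z : ℤ → B),
        IsToeplitz z ∧ ¬ IsPeriodicSeq z ∧
        IsPeriodStructure z (fun k => p (N + k)) ∧
        (letI : TopologicalSpace B := ⊥
         TopConj (orbitClosure x) (shiftMap^[c]) (orbitClosure z) shiftMap) := by
  have hpos : ∀ k, 0 < p k := fun k => (hps.2.1 k).1
  obtain ⟨N, hN1, hN⟩ := ps_cover hps 1 0 2
  have h0P : (0 : ℤ) ∈ PerSet x (p N) := by simpa using hN 0 (by omega)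
  have h1P : (1 : ℤ) ∈ PerSet x (p N) := by simpa using hN 1 (by omega)
  have hP2 : 2 ≤ p N := by
    have := hps.1 (show 0 < N by omega)
    have := hpos 0
    omega
  set P := p N with hPdef
  obtain ⟨ρ, hρo, hρ⟩ : ∃ ρ : (ℤ → A) → ZMod P, (∀ a, IsOpen (ρ ⁻¹' {a})) ∧
      ∀ m : ℤ, ρ (shiftZ m x) = (m : ZMod P) := exists_residue hps N
  haveI : NeZero P := ⟨by omega⟩
  have hcP : Nat.gcd c P = 1 := hgcd N
  have hc0 : (0 : ℤ) < c := by exact_mod_cast hc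
  let B : Type := ZMod P × (Fin (c * P) → A)
  let f : (ℤ → A) → B := fun y => (ρ y, fun i => y (if ρ y = 0 then ((i : ℕ) : ℤ) else 0))
  have hinj : ∀ y ∈ orbitClosure x, ∀ y' ∈ orbitClosure x,
      (∀ n : ℤ, f (shiftZ (c * n) y) = f (shiftZ (c * n) y')) → y = y' := by
    intro y hy y' hy' h
    have hmark : ∀ n0 : ℤ, ∃ j : Fin P, ρ (shiftZ (c * (n0 + (j : ℕ))) y) = 0 := by
      intro n0
      have hcl : IsClosed {y : ℤ → A | ∃ j : Fin P, ρ (shiftZ (c * (n0 + (j : ℕ))) y) = 0} := by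
        rw [Set.ofPred_exists]
        refine isClosed_iUnion_of_finite fun j => ?_
        have hρc : IsClosed (ρ ⁻¹' {0}) := by
          rw [← isOpen_compl_iff]
          have : (ρ ⁻¹' {0})ᶜ = ⋃ a ∈ {a : ZMod P | a ≠ 0}, ρ ⁻¹' {a} := by
            ext w; simp
          rw [this]
          exact isOpen_biUnion fun a _ => hρo a
        exact hρc.preimage (continuous_shiftZ (c * (n0 + (j : ℕ))))
      refine closure_minimal ?_ hcl hy
      rintro _ ⟨n, rfl⟩
      obtain ⟨n1, hn1⟩ := bezout_sol hcP (-n)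
      have hP0 : (0 : ℤ) < P := by omega
      have hq0 : 0 ≤ (n1 - n0) % P := Int.emod_nonneg _ hP0.ne'
      have hq1 : (n1 - n0) % P < P := Int.emod_lt_of_pos _ hP0
      have hq2 : (P : ℤ) ∣ (n1 - n0) - (n1 - n0) % P := Int.dvd_self_sub_emod
      obtain ⟨j, hj⟩ := Int.eq_ofNat_of_zero_le hq0
      rw [hj] at hq1 hq2
      refine ⟨⟨j, by exact_mod_cast hq1⟩, ?_⟩
      rw [shiftZ_shiftZ, hρ, ZMod.intCast_zmod_eq_zero_iff_dvd]
      have := dvd_sub hn1 (hq2.mul_left c)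
      refine dvd_cast this ?_
      ring
    funext t
    obtain ⟨⟨j, hj⟩, hm⟩ := hmark (t / c - P + 1)
    simp only at hm
    have hmm := h (t / c - P + 1 + j)
    have d1 : c * (t / c) ≤ t := Int.mul_ediv_self_le hc0.ne'
    have d2 : t < c * (t / c) + c := Int.lt_mul_ediv_self_add hc0
    set n : ℤ := t / c - P + 1 + j with hn
    have l1 : c * n ≤ c * (t / c) := mul_le_mul_of_nonneg_left (by omega) hc0.le
    have l2 : c * (t / c) + c ≤ c * n + c * P := by
      have : c * (t / (c : ℤ) + 1) ≤ c * (n + P) := mul_le_mul_of_nonneg_left (by omega) hc0.le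
      linarith
    have hlt : (t - c * n).toNat < c * P := by
      zify; rw [Int.toNat_of_nonneg (by linarith)]; linarith
    have hr : ρ (shiftZ (c * n) y') = 0 := by
      rw [← hm]; exact (congrArg Prod.fst hmm).symm
    have hb := congrFun (congrArg Prod.snd hmm) ⟨(t - c * n).toNat, hlt⟩
    simp only [f, hm, hr, if_true, shiftZ] at hb
    rw [Int.toNat_of_nonneg (by linarith), sub_add_cancel] at hb
    exact hb
  let z : ℤ → B := fun n => f (shiftZ (c * n) x)
  have hzdef : ∀ n, z n = (((c * n : ℤ) : ZMod P),
      fun i : Fin (c * P) => x ((if ((c * n : ℤ) : ZMod P) = 0 then ((i : ℕ) : ℤ) else 0) + c * n)) := by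
    intro n
    simp only [z, f, hρ]
    rfl
  have hcPpos : 0 < c * P := by positivity
  -- sufficient condition for membership in the periodic part of `z`
  have hperz : ∀ l, N ≤ l → ∀ n : ℤ,
      (∀ i : Fin (c * P), (if ((c * n : ℤ) : ZMod P) = 0 then ((i : ℕ) : ℤ) else 0) + c * n
        ∈ PerSet x (p l)) → n ∈ PerSet z (p l) := by
    intro l hl n h m
    have hd : (P : ℤ) ∣ p l := Int.natCast_dvd_natCast.2 (ps_dvd hps.2.2.1 hl)
    have e : ((c * (n + m * p l) : ℤ) : ZMod P) = ((c * n : ℤ) : ZMod P) := by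
      rw [ZMod.intCast_eq_intCast_iff_dvd_sub]
      have := (hd.mul_left (c * m)).neg_right
      refine dvd_cast this ?_; ring
    rw [hzdef, hzdef, e]
    refine Prod.ext rfl (funext fun i => ?_)
    exact (per_add (h i) ⟨c * m, by ring⟩).2
  have hzper : ∀ l, ∀ n : ℤ, n ∈ PerSet z (p l) → c * n ∈ PerSet x (p l) := by
    intro l n h
    apply per_mul hps hgcd
    intro m
    have h1 := h m
    rw [hzdef, hzdef] at h1
    have h2 := congrFun (congrArg Prod.snd h1) ⟨0, hcPpos⟩
    simp only [Nat.cast_zero, ite_self, zero_add] at h2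
    rw [← h2]; congr 1; ring
  have hcov : ∀ n : ℤ, ∃ l, N ≤ l ∧ n ∈ PerSet z (p l) := by
    intro n
    obtain ⟨l, hl, h⟩ := ps_cover hps N (c * n) (c * P)
    refine ⟨l, hl, hperz l hl n fun i => ?_⟩
    split_ifs
    · rw [add_comm]; exact h i i.2
    · simpa using h 0 hcPpos
  refine ⟨N, ps_tail hps N, B, inferInstance, z, ?_, ?_, ?_, ?_⟩
  · intro n
    obtain ⟨l, -, h⟩ := hcov n
    exact ⟨p l, hpos l, h⟩
  · rintro ⟨n, hn, h⟩
    apply hnp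
    refine ⟨c * n, by positivity, ?_⟩
    have := hinj _ (self_mem x (c * n)) _ (self_mem x 0) (fun m => by
      have := h m
      simp only [z] at this
      rw [shiftZ_shiftZ, shiftZ_shiftZ, add_zero, ← this]
      congr 2; ring)
    intro m
    have := congrFun this m
    simp only [shiftZ, add_zero] at this
    push_cast
    exact this
  · refine ⟨fun i j hij => hps.1 (by omega), fun k => ⟨hpos _, ?_⟩, fun k => hps.2.2.1 _, ?_⟩
    · rintro ⟨q, hq0, hq1, himg, hval⟩
      have hl : N ≤ N + k := by omega
      simp only at hq1 himg hval
      generalize N + k = l at hl hq1 himg hval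
      have hdN : P ∣ p l := ps_dvd hps.2.2.1 hl
      have hd : (P : ℤ) ∣ p l := Int.natCast_dvd_natCast.2 hdN
      -- positions outside the class of `0`
      have single : ∀ k ∈ PerSet x (p l), ¬ (P : ℤ) ∣ k → ∃ n : ℤ, (p l : ℤ) ∣ c * n - k ∧
          n ∈ PerSet z (p l) := by
        intro k hk hPk
        obtain ⟨n, hn⟩ := bezout_sol (hgcd l) k
        refine ⟨n, hn, hperz l hl n fun i => ?_⟩
        rw [if_neg, zero_add]
        · exact (per_add hk hn).1
        · rw [ZMod.intCast_zmod_eq_zero_iff_dvd]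
          intro h
          apply hPk
          have := dvd_sub h (hd.trans hn)
          simpa using this
      have hPq : (P : ℤ) ∣ c * q := by
        obtain ⟨n, -, hn⟩ := single 1 (per_mono hdN h1P) (by
          intro h
          have := Int.le_of_dvd one_pos h
          omega)
        have h1 := hval n hn
        rw [hzdef, hzdef] at h1
        have h2 := congrArg Prod.fst h1
        simp only at h2
        rw [eq_comm, ZMod.intCast_eq_intCast_iff_dvd_sub] at h2
        refine dvd_cast h2 ?_; ring
      have hfin : (p l : ℤ) ∣ c * q := by
        apply not_ess (hps.2.1 l)
        intro k hk
        by_cases hPk : (P : ℤ) ∣ k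
        · have a1 := per_add (k' := k) h0P (by simpa using hPk)
          have a2 := per_add (k' := k + c * q) h0P (by simpa using dvd_add hPk hPq)
          exact ⟨per_mono hdN a2.1, a2.2.trans a1.2.symm⟩
        · obtain ⟨n, hn, hnz⟩ := single k hk hPk
          have hnq : n + q ∈ PerSet z (p l) := by
            rw [← himg]; exact ⟨n, hnz, rfl⟩
          have b1 := hzper l _ hnq
          have b2 := per_add (k' := k + c * q) b1 (by
            refine dvd_cast hn.neg_right ?_; ring)
          have b3 := per_add hk hn
          have h1 := hval n hnz
          rw [hzdef, hzdef] at h1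
          have h2 := congrFun (congrArg Prod.snd h1) ⟨0, hcPpos⟩
          simp only [Nat.cast_zero, ite_self, zero_add] at h2
          exact ⟨b2.1, by rw [b2.2, h2, b3.2]⟩
      have hfin' : p l ∣ c * q := by exact_mod_cast hfin
      have := Nat.Coprime.dvd_of_dvd_mul_left (Nat.Coprime.symm (hgcd l)) hfin'
      exact absurd (Nat.le_of_dvd hq0 this) (by omega)
    · rw [Set.eq_univ_iff_forall]
      intro n
      obtain ⟨l, hl, h⟩ := hcov n
      refine Set.mem_iUnion.2 ⟨l - N, ?_⟩
      show n ∈ PerSet z (p (N + (l - N)))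
      rw [show N + (l - N) = l by omega]
      exact h
  · letI : TopologicalSpace B := ⊥
    haveI : DiscreteTopology B := ⟨rfl⟩
    refine conj_of_code hps hgcd f ?_ hinj
    rw [continuous_discrete_rng]
    rintro ⟨a, u⟩
    have : f ⁻¹' {(a, u)} = ρ ⁻¹' {a} ∩
        (fun (y : ℤ → A) (i : Fin (c * P)) => y (if a = 0 then ((i : ℕ) : ℤ) else 0)) ⁻¹' {u} := by
      ext y
      simp only [f, B, Set.mem_preimage, Set.mem_singleton_iff, Set.mem_inter_iff]
      rw [Prod.mk.injEq]
      constructor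
      · rintro ⟨h1, h2⟩; subst h1; exact ⟨rfl, h2⟩
      · rintro ⟨h1, h2⟩; subst h1; exact ⟨rfl, h2⟩
    rw [this]
    refine (hρo a).inter ((isOpen_discrete {u}).preimage ?_)
    exact continuous_pi fun i => continuous_apply _

end
end
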